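/- arXiv:0709.2346 — 6 statements merged into one kernel-verified Lean document; each statement's English description precedes it below -/
import Mathlib

section
/- Let C be an information-lossless pushdown compressor with k states, working without an endmarker. Then for every input word w with |w| ≥ k, the compression ratio satisfies |C(w)|/|w| ≥ 1/(2k). -/
/-- A pushdown transducer with input alphabet `In`, output alphabet `Out`,
stack alphabet `Γ` and state set `Q`.  A transition `δ q none z` is a
`λ`-rule (no input symbol is read); `det` is the determinism requirement that
for every state and top stack symbol, either the `λ`-rule or all the reading
rules are undefined; `bottom` requires that the bottom-of-stack symbol `z₀`
is never removed from the bottom of the stack. -/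
structure PDT (In Out Γ Q : Type*) where
  δ : Q → Option In → Γ → Option (Q × List Γ)
  ν : Q → Option In → Γ → List Out
  q₀ : Q
  z₀ : Γ
  det : ∀ q z, δ q none z = none ∨ ∀ b, δ q (some b) z = none
  bottom : ∀ q b p, δ q b z₀ = some p → ∃ q' v, p = (q', v ++ [z₀])

namespace PDT

variable {In Out Γ Q : Type*}

/-- Instantaneous description: current state, stack (top first), remaining
input, and output produced so far. -/
abbrev ID (In Out Γ Q : Type*) := Q × List Γ × List In × List Out

/-- One computation step of a pushdown transducer: either a `λ`-rule, or the
reading of one input symbol; in both cases the top stack symbol is replaced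
by a (possibly empty) word and the corresponding output is appended. -/
inductive Step (M : PDT In Out Γ Q) : ID In Out Γ Q → ID In Out Γ Q → Prop
  | lam {q z s inp out q' v} : M.δ q none z = some (q', v) →
      Step M (q, z :: s, inp, out) (q', v ++ s, inp, out ++ M.ν q none z)
  | read {q z s b inp out q' v} : M.δ q (some b) z = some (q', v) →
      Step M (q, z :: s, b :: inp, out) (q', v ++ s, inp, out ++ M.ν q (some b) z)

/-- An ID is terminal when the input has been entirely read and no `λ`-rule
is enabled. -/
def Terminal (M : PDT In Out Γ Q) : ID In Out Γ Q → Prop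
  | (q, s, inp, _) => inp = [] ∧ ∀ z s', s = z :: s' → M.δ q none z = none

/-- `M.Computes w qf o`: the complete run of `M` on input `w` ends in state
`qf` having produced the total output `o`. -/
def Computes (M : PDT In Out Γ Q) (w : List In) (qf : Q) (o : List Out) : Prop :=
  ∃ s, Relation.ReflTransGen (Step M) (M.q₀, [M.z₀], w, []) (qf, s, [], o) ∧
    Terminal M (qf, s, [], o)

end PDT

/-- A pushdown compressor (working without endmarker) over the alphabet `A`:
a pushdown transducer with input and output alphabet `A` whose computation
terminates on every input, hence computing a total function. -/
structure PDC (A Γ Q : Type*) extends PDT A A Γ Q where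
  total : ∀ w : List A, ∃ qf o, toPDT.Computes w qf o

namespace PDC
variable {A Γ Q : Type*}

/-- The state `δ_Q(w)` reached by the compressor after processing `w`. -/
noncomputable def finalState (M : PDC A Γ Q) (w : List A) : Q := (M.total w).choose

/-- `M.output w` is `C(w)`, the output of the compressor on input `w`. -/
noncomputable def output (M : PDC A Γ Q) (w : List A) : List A :=
  (M.total w).choose_spec.choose

/-- Information-losslessness: the map `w ↦ (C(w), δ_Q(w))` is injective. -/
def IL (M : PDC A Γ Q) : Prop :=
  Function.Injective fun w => (M.output w, M.finalState w)


end PDC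

namespace PDT

variable {In Out Γ Q : Type*} {M : PDT In Out Γ Q}

theorem step_rightUnique : Relator.RightUnique (Step M) := by
  rintro _ _ _ h₁ h₂
  cases h₁ with
  | @lam q z s inp out q' v h =>
    cases h₂ with
    | lam h' =>
      rw [h] at h'
      cases h'
      rfl
    | @read _ _ _ b _ _ _ _ h' =>
      rcases M.det q z with hd | hd
      · simp [hd] at h
      · simp [hd b] at h'
  | @read q z s b inp out q' v h =>
    cases h₂ with
    | lam h' =>
      rcases M.det q z with hd | hd
      · simp [hd] at h'
      · simp [hd b] at h
    | read h' =>
      rw [h] at h'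
      cases h'
      rfl

/-- Input that has not been read yet may be extended. -/
theorem Step.append_input {c d : ID In Out Γ Q} (h : Step M c d) (y : List In) :
    Step M (c.1, c.2.1, c.2.2.1 ++ y, c.2.2.2) (d.1, d.2.1, d.2.2.1 ++ y, d.2.2.2) := by
  cases h with
  | lam h => exact .lam h
  | read h => exact .read h

theorem Step.output_prefix {c d : ID In Out Γ Q} (h : Step M c d) :
    c.2.2.2 <+: d.2.2.2 := by
  cases h with
  | lam h => exact List.prefix_append _ _
  | read h => exact List.prefix_append _ _

theorem output_prefix_of_reflTransGen {c d : ID In Out Γ Q}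
    (h : Relation.ReflTransGen (Step M) c d) : c.2.2.2 <+: d.2.2.2 := by
  induction h with
  | refl => exact List.prefix_rfl
  | tail _ hs ih => exact ih.trans hs.output_prefix

theorem Terminal.not_step {c d : ID In Out Γ Q} (hc : Terminal M c) : ¬ Step M c d := by
  intro h
  cases h with
  | lam h => simp [hc.2 _ _ rfl] at h
  | read h => exact List.cons_ne_nil _ _ hc.1

theorem Computes.output_prefix {x y : List In} {q q' : Q} {o o' : List Out}
    (h : M.Computes x q o) (h' : M.Computes (x ++ y) q' o') : o <+: o' := by
  obtain ⟨s, hs, -⟩ := h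
  obtain ⟨s', hs', ht⟩ := h'
  have hlift : Relation.ReflTransGen (Step M) (M.q₀, [M.z₀], x ++ y, []) (q, s, [] ++ y, o) :=
    hs.lift (fun c => (c.1, c.2.1, c.2.2.1 ++ y, c.2.2.2)) fun _ _ h => h.append_input y
  rcases Relation.ReflTransGen.total_of_right_unique step_rightUnique hlift hs' with h | h
  · exact output_prefix_of_reflTransGen h
  · rcases h.cases_head with h | ⟨_, h, -⟩
    · cases h
      exact List.prefix_rfl
    · exact absurd h ht.not_step

end PDT

namespace PDC

variable {A Γ Q : Type*}

theorem computes_output (C : PDC A Γ Q) (w : List A) :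
    C.toPDT.Computes w (C.finalState w) (C.output w) :=
  (C.total w).choose_spec.choose_spec

theorem output_prefix_of_prefix (C : PDC A Γ Q) {x w : List A} (h : x <+: w) :
    C.output x <+: C.output w := by
  obtain ⟨y, rfl⟩ := h
  exact (C.computes_output x).output_prefix (C.computes_output (x ++ y))

/-- While reading as many symbols as it has states, an information-lossless
compressor outputs at least one symbol. -/
theorem IL.output_take_lt [Fintype Q] {C : PDC A Γ Q} (hC : C.IL) {w : List A} {i : ℕ}
    (hi : i + Fintype.card Q ≤ w.length) :
    (C.output (w.take i)).length < (C.output (w.take (i + Fintype.card Q))).length := by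
  by_contra! hle
  have heq (j : Fin (Fintype.card Q + 1)) : C.output (w.take (i + j)) = C.output (w.take i) := by
    have h₁ := C.output_prefix_of_prefix
      (List.take_prefix_take_left (l := w) (show i ≤ i + (j : ℕ) by omega))
    have h₂ := C.output_prefix_of_prefix
      (List.take_prefix_take_left (l := w) (show i + (j : ℕ) ≤ i + Fintype.card Q by omega))
    exact (h₁.eq_of_length_le (h₂.length_le.trans hle)).symm
  obtain ⟨a, b, hab, hst⟩ := Fintype.exists_ne_map_eq_of_card_lt
    (fun j : Fin (Fintype.card Q + 1) => C.finalState (w.take (i + j))) (by simp)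
  have hlen := congrArg List.length (hC (Prod.ext ((heq a).trans (heq b).symm) hst))
  simp only [List.length_take] at hlen
  omega

theorem IL.le_length_output_take [Fintype Q] {C : PDC A Γ Q} (hC : C.IL) {w : List A} (m : ℕ)
    (hm : m * Fintype.card Q ≤ w.length) :
    m ≤ (C.output (w.take (m * Fintype.card Q))).length := by
  induction m with
  | zero => exact Nat.zero_le _
  | succ m ih =>
    rw [Nat.succ_mul] at hm ⊢
    exact (ih (by omega)).trans_lt (hC.output_take_lt hm)

theorem IL.length_div_card_le [Fintype Q] {C : PDC A Γ Q} (hC : C.IL) (w : List A) :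
    w.length / Fintype.card Q ≤ (C.output w).length :=
  (hC.le_length_output_take _ (Nat.div_mul_le_self _ _)).trans
    (C.output_prefix_of_prefix (List.take_prefix _ _)).length_le

end PDC

/-- Let `C` be an information-lossless pushdown compressor
with `k` states, working without an endmarker.  Then for every input word `w`
with `|w| ≥ k`, the compression ratio satisfies `|C(w)|/|w| ≥ 1/(2k)`. -/
theorem ilpdc_ratio_lower_bound {A Γ Q : Type} [Fintype A] [Fintype Γ] [Fintype Q]
    (hA : 2 ≤ Fintype.card A) (C : PDC A Γ Q) (hIL : C.IL) (k : ℕ)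
    (hk : Fintype.card Q = k) (w : List A) (hw : k ≤ w.length) :
    (1 : ℝ) / (2 * k) ≤ ((C.output w).length : ℝ) / (w.length : ℝ) := by
  subst hk
  have hpos : 0 < Fintype.card Q := Fintype.card_pos_iff.mpr ⟨C.q₀⟩
  have hdiv := hIL.length_div_card_le w
  have hone : 1 ≤ w.length / Fintype.card Q := (Nat.one_le_div_iff hpos).mpr hw
  have hlt := Nat.lt_mul_div_succ w.length hpos
  have hle : w.length ≤ (C.output w).length * (2 * Fintype.card Q) := by nlinarith
  rw [div_le_div_iff₀ (by positivity) (by exact_mod_cast hpos.trans_le hw), one_mul]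
  exact_mod_cast hle
end

section
/- Let n ∈ ℕ and t,u ∈ Σ* with u ≠ λ. Set l = 1 + |t| + |u| and w_n = tuⁿ. Suppose the Lempel-Ziv algorithm LZ78 is run on w_n starting from a dictionary of phrases that already contains d > 0 phrases (coming from a previously parsed word), so that each new phrase is encoded by a pointer of length log(p+d) where p is the number of new phrases. Then |LZ(w_n)|/|w_n| ≤ √(2·l·|w_n|)·log(d + √(2·l·|w_n|)) / |w_n|. -/
/-- The number of phrases produced by the LZ78 parsing of the input word,
starting with the dictionary `dict` of already known phrases and with the
current candidate phrase `cur`: the parser extends the current phrase while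
it belongs to the dictionary, and closes it (adding it to the dictionary) as
soon as it is new. -/
def LZcount {A : Type*} [DecidableEq A] (dict : List (List A)) (cur : List A) :
    List A → ℕ
  | [] => if cur = [] then 0 else 1
  | b :: rest =>
    if (cur ++ [b]) ∈ dict then LZcount dict (cur ++ [b]) rest
    else LZcount ((cur ++ [b]) :: dict) [] rest + 1
  termination_by x => x.length

/-- The number of phrases `P(x)` in the LZ78 parsing of `x`. -/
def LZP {A : Type*} [DecidableEq A] (x : List A) : ℕ := LZcount [] [] x

/-- Length in bits `|LZ(x)|` of the LZ78 compression of `x`: each of the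
`p = P(x)` phrases is encoded by a pointer of `log₂ p` bits towards a
previous phrase of the dictionary (together with one extra symbol). -/
noncomputable def LZlen {A : Type*} [DecidableEq A] (x : List A) : ℝ :=
  (LZP x : ℝ) * Real.logb 2 (LZP x)

/-- If every positive integer occurs at most `l` times in a multiset of positive integers, then
the sum of the multiset is at least quadratic in its cardinality. -/
theorem Multiset.card_mul_succ_le_of_count_le (l : ℕ) (S : Multiset ℕ) (h0 : 0 ∉ S)
    (hc : ∀ k, S.count k ≤ l) : S.card * (S.card + 1) ≤ 2 * l * S.sum := by
  induction hn : S.card generalizing S with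
  | zero => simp
  | succ n ih =>
    have hne : S.toFinset.Nonempty := by
      rw [Multiset.toFinset_nonempty]
      rintro rfl
      simp at hn
    obtain ⟨m, hm, hmax⟩ := Finset.exists_max_image S.toFinset id hne
    rw [Multiset.mem_toFinset] at hm
    have hcard : n + 1 ≤ m * l := by
      rw [← hn, ← Multiset.toFinset_sum_count_eq]
      have hsub : S.toFinset ⊆ Finset.Icc 1 m := by
        intro a ha
        rw [Finset.mem_Icc]
        refine ⟨Nat.one_le_iff_ne_zero.2 ?_, hmax a ha⟩
        rintro rfl
        exact h0 (Multiset.mem_toFinset.1 ha)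
      calc ∑ a ∈ S.toFinset, S.count a ≤ S.toFinset.card * l :=
            Finset.sum_le_card_nsmul _ _ _ fun a _ => hc a
        _ ≤ m * l := by
            gcongr
            simpa using Finset.card_le_card hsub
    obtain ⟨T, rfl⟩ := Multiset.exists_cons_of_mem hm
    have hT := ih T (fun h => h0 (Multiset.mem_cons_of_mem h))
      (fun k => (Multiset.count_le_count_cons k m T).trans (hc k)) (by simpa using hn)
    rw [Multiset.sum_cons]
    nlinarith

/-- The LZ78 parsing splits the input into distinct nonempty new phrases, followed by a possibly
empty unfinished phrase. -/
theorem exists_phrases_LZcount {A : Type*} [DecidableEq A] (dict : List (List A)) (cur x : List A) :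
    ∃ (L : List (List A)) (e : List A),
      LZcount dict cur x = L.length + (if e = [] then 0 else 1) ∧
      L.flatten ++ e = cur ++ x ∧ L.Nodup ∧ ∀ p ∈ L, p ≠ [] ∧ p ∉ dict := by
  induction x generalizing dict cur with
  | nil => exact ⟨[], cur, by simp [LZcount]⟩
  | cons b rest ih =>
    by_cases h : cur ++ [b] ∈ dict
    · obtain ⟨L, e, h1, h2, h3⟩ := ih dict (cur ++ [b])
      exact ⟨L, e, by rw [LZcount, if_pos h, h1], by simpa using h2, h3⟩
    · obtain ⟨L, e, h1, h2, h3, h4⟩ := ih ((cur ++ [b]) :: dict) []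
      refine ⟨(cur ++ [b]) :: L, e, ?_, ?_, ?_, ?_⟩
      · rw [LZcount, if_neg h, h1, List.length_cons]
        omega
      · rw [List.nil_append] at h2
        simp [h2]
      · exact List.nodup_cons.2 ⟨fun hL => (h4 _ hL).2 List.mem_cons_self, h3⟩
      · intro p hp
        rcases List.mem_cons.1 hp with rfl | hp
        · exact ⟨by simp, h⟩
        · exact ⟨(h4 p hp).1, fun hd => (h4 p hp).2 (List.mem_cons_of_mem _ hd)⟩

/-- Every factor of the eventually periodic word `t uⁿ` occurs at a position smaller than
`|t| + |u|`. -/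
theorem exists_prefix_drop_of_infix {A : Type*} (t u : List A) (hu : u ≠ []) (n : ℕ) (p : List A)
    (hp : p <:+: t ++ (List.replicate n u).flatten) :
    ∃ j < t.length + u.length, p <+: (t ++ (List.replicate n u).flatten).drop j := by
  have hul := List.length_pos_iff.2 hu
  set w := t ++ (List.replicate n u).flatten with hw
  have hper : w.drop (t.length + u.length) <+: w.drop t.length := by
    rw [hw, List.drop_length_add_append, List.drop_left]
    cases n with
    | zero => simp
    | succ m =>
      have h1 : (List.replicate (m + 1) u).flatten = u ++ (List.replicate m u).flatten := by
        simp [List.replicate_succ]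
      have h2 : (List.replicate (m + 1) u).flatten = (List.replicate m u).flatten ++ u := by
        simp [List.replicate_succ']
      rw [h1, List.drop_left, ← h1, h2]
      exact List.prefix_append _ _
  obtain ⟨a, c, hac⟩ := hp
  have hstart : p <+: w.drop a.length := ⟨c, by rw [← hac]; simp⟩
  generalize a.length = i at hstart
  induction i using Nat.strong_induction_on with
  | _ i ih =>
    by_cases hi : i < t.length + u.length
    · exact ⟨i, hi, hstart⟩
    · refine ih (i - u.length) (by omega) (hstart.trans ?_)
      have := hper.drop (i - (t.length + u.length))
      rw [List.drop_drop, List.drop_drop] at this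
      convert this using 2 <;> omega

/-- The number of LZ78 phrases of `t uⁿ` is at most of the order of the square root of its
length. -/
theorem LZcount_sq_le {A : Type*} [DecidableEq A] (t u : List A) (hu : u ≠ []) (n : ℕ)
    (D : List (List A)) :
    LZcount D [] (t ++ (List.replicate n u).flatten) ^ 2 ≤
      2 * (1 + t.length + u.length) * (t ++ (List.replicate n u).flatten).length := by
  obtain ⟨L, e, h1, h2, h3, h4⟩ :=
    exists_phrases_LZcount D [] (t ++ (List.replicate n u).flatten)
  have hinfix := exists_prefix_drop_of_infix t u hu n
  rw [h1]
  set w := t ++ (List.replicate n u).flatten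
  rw [List.nil_append] at h2
  have hcount : ∀ k, (L.map List.length).count k ≤ t.length + u.length := by
    intro k
    have hnd : (L.filter fun p => p.length = k).Nodup := h3.filter _
    have hsub : (L.filter fun p => p.length = k).toFinset ⊆
        (Finset.range (t.length + u.length)).image fun j => (w.drop j).take k := by
      intro p hp
      simp only [List.mem_toFinset, List.mem_filter, decide_eq_true_eq] at hp
      have hpw : p <:+: w := by
        rw [← h2]
        exact (List.infix_of_mem_flatten hp.1).trans (List.prefix_append _ _).isInfix
      obtain ⟨j, hj, hpj⟩ := hinfix p hpw
      refine Finset.mem_image.2 ⟨j, Finset.mem_range.2 hj, ?_⟩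
      rw [← hp.2]
      exact (List.prefix_iff_eq_take.1 hpj).symm
    have hle := (Finset.card_le_card hsub).trans Finset.card_image_le
    rw [List.toFinset_card_of_nodup hnd, Finset.card_range] at hle
    rw [List.count, List.countP_map, List.countP_eq_length_filter]
    simpa [Function.comp_def, beq_eq_decide] using hle
  have hmem : 0 ∉ L.map List.length := by
    simp only [List.mem_map, List.length_eq_zero_iff, not_exists, not_and]
    exact fun p hp => (h4 p hp).1
  have hsum : (L.map List.length).sum + e.length = w.length := by
    rw [← h2, List.length_append, List.length_flatten]
  split_ifs with he
  · have := Multiset.card_mul_succ_le_of_count_le (1 + t.length + u.length)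
      (L.map List.length : Multiset ℕ) (by simpa using hmem) (fun k => by
        rw [Multiset.coe_count]
        have := hcount k
        omega)
    rw [Multiset.coe_card, Multiset.sum_coe, List.length_map] at this
    subst he
    rw [← hsum, List.length_nil]
    nlinarith
  · have := Multiset.card_mul_succ_le_of_count_le (1 + t.length + u.length)
      ((e.length :: L.map List.length : List ℕ) : Multiset ℕ) (by
        rw [Multiset.mem_coe, List.mem_cons, not_or]
        exact ⟨fun h => he (List.length_eq_zero_iff.1 h.symm), hmem⟩) (fun k => by
        rw [Multiset.coe_count, List.count_cons]
        have := hcount k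
        split_ifs <;> omega)
    rw [Multiset.coe_card, Multiset.sum_coe, List.length_cons, List.length_map, List.sum_cons,
      add_comm e.length, hsum] at this
    nlinarith

/-- Let `n ∈ ℕ` and `t, u ∈ Σ*` with `u ≠ λ`.  Set
`l = 1 + |t| + |u|` and `wₙ = tuⁿ`.  Suppose LZ78 is run on `wₙ` starting
from a dictionary `D` that already contains `d > 0` phrases (coming from a
previously parsed word), so that each of the `p` new phrases is encoded by a
pointer of length `log(p + d)`.  Then
`|LZ(wₙ)|/|wₙ| ≤ √(2·l·|wₙ|)·log(d + √(2·l·|wₙ|)) / |wₙ|`. -/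
theorem lz_on_periodic_word {A : Type} [Fintype A] [DecidableEq A]
    (hA : 2 ≤ Fintype.card A) (t u : List A) (hu : u ≠ []) (n : ℕ)
    (D : List (List A)) (hD : D.Nodup) (d : ℕ) (hDd : D.length = d) (hd : 0 < d) :
    (LZcount D [] (t ++ (List.replicate n u).flatten) : ℝ) *
        Real.logb 2 ((LZcount D [] (t ++ (List.replicate n u).flatten) : ℝ) + d) /
        ((t ++ (List.replicate n u).flatten).length : ℝ) ≤
      Real.sqrt (2 * (1 + t.length + u.length) *
          ((t ++ (List.replicate n u).flatten).length : ℝ)) *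
        Real.logb 2 ((d : ℝ) + Real.sqrt (2 * (1 + t.length + u.length) *
          ((t ++ (List.replicate n u).flatten).length : ℝ))) /
        ((t ++ (List.replicate n u).flatten).length : ℝ) := by
  have hle : (LZcount D [] (t ++ (List.replicate n u).flatten) : ℝ) ≤
      Real.sqrt (2 * (1 + t.length + u.length) *
        ((t ++ (List.replicate n u).flatten).length : ℝ)) :=
    Real.le_sqrt_of_sq_le (by exact_mod_cast LZcount_sq_le t u hu n D)
  have hd1 : (1 : ℝ) ≤ d := by exact_mod_cast hd
  have hp : (0 : ℝ) ≤ LZcount D [] (t ++ (List.replicate n u).flatten) := Nat.cast_nonneg _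
  refine div_le_div_of_nonneg_right ?_ (Nat.cast_nonneg _)
  refine mul_le_mul hle ?_ (Real.logb_nonneg one_lt_two (by linarith)) (Real.sqrt_nonneg _)
  exact Real.logb_le_logb_of_le one_lt_two (by linarith) (by linarith)
end

section
/- Let t,u ∈ Σ* with u ≠ λ be fixed. Then |LZ(tuⁿ)|/|tuⁿ| = O(log n / √n) as n → ∞; that is, there exist a constant c > 0 and N such that for all n ≥ N, |LZ(tuⁿ)|/|tuⁿ| ≤ c·(log n)/√n. -/
/-- All phrases of an LZ78 parsing, except possibly the last one, are pairwise distinct. -/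
theorem exists_nodup_phrases {A : Type*} [DecidableEq A] (x : List A) :
    ∀ (dict : List (List A)) (cur : List A), ∃ (ps : List (List A)) (r : List A),
      cur ++ x = ps.flatten ++ r ∧ LZcount dict cur x ≤ ps.length + 1 ∧ ps.Nodup ∧
        ∀ p ∈ ps, p ∉ dict := by
  induction x with
  | nil =>
    intro dict cur
    refine ⟨[], cur, by simp, ?_, by simp, by simp⟩
    rw [LZcount]
    split <;> simp
  | cons b rest ih =>
    intro dict cur
    rw [LZcount]
    split
    · obtain ⟨ps, r, h, hk, hn, hd⟩ := ih dict (cur ++ [b])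
      exact ⟨ps, r, by simpa using h, hk, hn, hd⟩
    · rename_i hb
      obtain ⟨ps, r, h, hk, hn, hd⟩ := ih ((cur ++ [b]) :: dict) []
      refine ⟨(cur ++ [b]) :: ps, r, ?_, by simpa using hk, ?_, ?_⟩
      · simpa using h
      · exact List.nodup_cons.2 ⟨fun hm => hd _ hm (by simp), hn⟩
      · intro p hp
        rcases List.mem_cons.1 hp with rfl | hp
        · exact hb
        · exact fun hm => hd p hp (List.mem_cons_of_mem _ hm)

theorem mul_length_filter_le_length_flatten {A : Type*} (m : ℕ) (ps : List (List A)) :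
    m * (ps.filter (fun p => ¬ p.length < m)).length ≤ ps.flatten.length := by
  induction ps with
  | nil => simp
  | cons p ps ih =>
    by_cases h : p.length < m
    · rw [List.filter_cons_of_neg (by simpa using h)]
      simp only [List.flatten_cons, List.length_append]
      omega
    · rw [List.filter_cons_of_pos (by simpa using h)]
      simp only [List.flatten_cons, List.length_append, List.length_cons, mul_add]
      omega

theorem flatten_replicate_drop_prefix {A : Type*} (u : List A) (n : ℕ) :
    (List.replicate n u).flatten.drop u.length <+: (List.replicate n u).flatten := by
  cases n with
  | zero => simp
  | succ n =>
    have h : (List.replicate (n + 1) u).flatten.drop u.length = (List.replicate n u).flatten := by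
      simp [List.replicate_succ]
    rw [h, List.replicate_succ', List.flatten_append]
    exact List.prefix_append _ _

/-- Every factor of `tuⁿ` already occurs at a position smaller than `|t| + |u|`. -/
theorem exists_lt_prefix_drop {A : Type*} (t u p : List A) (hu : u ≠ []) (n i : ℕ)
    (h : p <+: (t ++ (List.replicate n u).flatten).drop i) :
    ∃ j < t.length + u.length, p <+: (t ++ (List.replicate n u).flatten).drop j := by
  have hu' : 0 < u.length := List.length_pos_iff.2 hu
  induction i using Nat.strong_induction_on with
  | _ i ih =>
    by_cases hi : i < t.length + u.length
    · exact ⟨i, hi, h⟩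
    · obtain ⟨k, rfl⟩ : ∃ k, i = t.length + (u.length + k) :=
        ⟨i - (t.length + u.length), by omega⟩
      refine ih (t.length + k) (by omega) ?_
      rw [List.drop_length_add_append] at h ⊢
      refine h.trans ?_
      rw [← List.drop_drop]
      exact (flatten_replicate_drop_prefix u n).drop k

/-- For every cut-off `m`, the number of phrases of `tuⁿ` is bounded by counting separately
the phrases shorter than `m` and the others. -/
theorem exists_LZP_le {A : Type*} [DecidableEq A] (t u : List A) (hu : u ≠ []) (n m : ℕ) :
    ∃ k, m * k ≤ (t ++ (List.replicate n u).flatten).length ∧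
      LZP (t ++ (List.replicate n u).flatten) ≤ (t.length + u.length) * m + k + 1 := by
  obtain ⟨ps, r, h, hk, hn, -⟩ :=
    exists_nodup_phrases (t ++ (List.replicate n u).flatten) [] []
  rw [List.nil_append] at h
  have hlong := mul_length_filter_le_length_flatten m ps
  refine ⟨(ps.filter (fun p => ¬ p.length < m)).length, ?_, ?_⟩
  · rw [h, List.length_append]
    omega
  have hshort : (ps.filter (fun p => p.length < m)).length ≤ (t.length + u.length) * m := by
    rw [← List.toFinset_card_of_nodup (hn.filter _)]
    have hsub : (ps.filter (fun p => p.length < m)).toFinset ⊆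
        (Finset.range (t.length + u.length) ×ˢ Finset.range m).image
          (fun q => ((t ++ (List.replicate n u).flatten).drop q.1).take q.2) := by
      intro p hp
      simp only [List.mem_toFinset, List.mem_filter, decide_eq_true_eq] at hp
      obtain ⟨a, b, rfl⟩ := List.append_of_mem hp.1
      obtain ⟨j, hj, hpj⟩ := exists_lt_prefix_drop t u p hu n a.flatten.length (by
        rw [h]
        simp)
      simp only [Finset.mem_image, Finset.mem_product, Finset.mem_range, Prod.exists]
      exact ⟨j, p.length, ⟨hj, hp.2⟩, (List.prefix_iff_eq_take.1 hpj).symm⟩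
    refine (Finset.card_le_card hsub).trans (Finset.card_image_le.trans ?_)
    simp
  have hsum : (ps.filter (fun p => p.length < m)).length +
      (ps.filter (fun p => ¬ p.length < m)).length = ps.length := by
    simpa [← decide_not] using
      (List.length_eq_length_filter_add (l := ps) (fun p => p.length < m)).symm
  unfold LZP
  omega

theorem LZP_le_mul_sqrt {A : Type*} [DecidableEq A] (t u : List A) (hu : u ≠ []) (n : ℕ)
    (hn : 1 ≤ n) :
    (LZP (t ++ (List.replicate n u).flatten) : ℝ) ≤
      4 * ((t.length + u.length : ℕ) : ℝ) * Real.sqrt n := by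
  have hu' : 0 < u.length := List.length_pos_iff.2 hu
  obtain ⟨k, hk, hP⟩ := exists_LZP_le t u hu n (Nat.sqrt n + 1)
  set D := t.length + u.length with hD
  have hlen : (t ++ (List.replicate n u).flatten).length ≤ D * n := by
    simp only [List.length_append, List.length_flatten, List.map_replicate, List.sum_replicate,
      smul_eq_mul, hD]
    nlinarith
  have hs1 : (1 : ℝ) ≤ Real.sqrt n := Real.one_le_sqrt.2 (by exact_mod_cast hn)
  have hss : Real.sqrt n * Real.sqrt n = n := Real.mul_self_sqrt (Nat.cast_nonneg n)
  have hlo : (Nat.sqrt n : ℝ) ≤ Real.sqrt n := Real.nat_sqrt_le_real_sqrt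
  have hhi : Real.sqrt n ≤ (Nat.sqrt n : ℝ) + 1 := Real.real_sqrt_le_nat_sqrt_succ
  have hD1 : (1 : ℝ) ≤ D := by exact_mod_cast (show 1 ≤ D by omega)
  have hkR : ((Nat.sqrt n : ℝ) + 1) * k ≤ D * n := by exact_mod_cast hk.trans hlen
  have hPR : (LZP (t ++ (List.replicate n u).flatten) : ℝ) ≤
      D * ((Nat.sqrt n : ℝ) + 1) + k + 1 := by exact_mod_cast hP
  have hk' : (k : ℝ) ≤ D * Real.sqrt n := by
    refine le_of_mul_le_mul_left ?_ (zero_lt_one.trans_le hs1)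
    calc Real.sqrt n * k ≤ ((Nat.sqrt n : ℝ) + 1) * k := by gcongr
      _ ≤ D * n := hkR
      _ = Real.sqrt n * (D * Real.sqrt n) := by rw [← hss]; ring_nf; simp
  nlinarith [mul_le_mul_of_nonneg_left hlo (zero_le_one.trans hD1),
    mul_le_mul_of_nonneg_left hs1 (zero_le_one.trans hD1)]

/-- Let `t, u ∈ Σ*` with `u ≠ λ` be fixed.  Then
`|LZ(tuⁿ)|/|tuⁿ| = O(log n / √n)` as `n → ∞`: there exist a constant `c > 0`
and `N` such that for all `n ≥ N`, `|LZ(tuⁿ)|/|tuⁿ| ≤ c·(log n)/√n`. -/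
theorem lz_ratio_periodic_bigO {A : Type} [Fintype A] [DecidableEq A]
    (hA : 2 ≤ Fintype.card A) (t u : List A) (hu : u ≠ []) :
    ∃ c : ℝ, 0 < c ∧ ∃ N : ℕ, ∀ n : ℕ, N ≤ n →
      LZlen (t ++ (List.replicate n u).flatten) /
          ((t ++ (List.replicate n u).flatten).length : ℝ) ≤
        c * Real.logb 2 (n : ℝ) / Real.sqrt (n : ℝ) := by
  have hu' : 0 < u.length := List.length_pos_iff.2 hu
  set D := t.length + u.length with hD
  have hD1 : 1 ≤ D := by omega
  have hD1R : (1 : ℝ) ≤ D := by exact_mod_cast hD1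
  refine ⟨4 * D, by positivity, (4 * D) ^ 2, fun n hn => ?_⟩
  have hn1 : 1 ≤ n := le_trans (Nat.one_le_pow _ _ (by omega)) hn
  have hn1R : (1 : ℝ) ≤ n := by exact_mod_cast hn1
  have hs0 : 0 < Real.sqrt n := Real.sqrt_pos.2 (by linarith)
  have hss : Real.sqrt n * Real.sqrt n = n := Real.mul_self_sqrt (Nat.cast_nonneg n)
  have hP := LZP_le_mul_sqrt t u hu n hn1
  have hlen : n ≤ (t ++ (List.replicate n u).flatten).length := by
    simp only [List.length_append, List.length_flatten, List.map_replicate, List.sum_replicate,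
      smul_eq_mul]
    nlinarith
  have hDs : (4 * D : ℝ) ≤ Real.sqrt n :=
    Real.le_sqrt_of_sq_le (by exact_mod_cast hn)
  have hPn : (LZP (t ++ (List.replicate n u).flatten) : ℝ) ≤ n :=
    hP.trans ((mul_le_mul_of_nonneg_right hDs hs0.le).trans hss.le)
  have hlogn : 0 ≤ Real.logb 2 (n : ℝ) := Real.logb_nonneg one_lt_two hn1R
  have hlog : Real.logb 2 (LZP (t ++ (List.replicate n u).flatten)) ≤ Real.logb 2 (n : ℝ) := by
    rcases Nat.eq_zero_or_pos (LZP (t ++ (List.replicate n u).flatten)) with h0 | h0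
    · simpa [h0] using hlogn
    · exact Real.logb_le_logb_of_le one_lt_two (by exact_mod_cast h0) hPn
  have hLZ : LZlen (t ++ (List.replicate n u).flatten) ≤
      4 * D * Real.sqrt n * Real.logb 2 (n : ℝ) := by
    unfold LZlen
    exact (mul_le_mul_of_nonneg_left hlog (Nat.cast_nonneg _)).trans
      (mul_le_mul_of_nonneg_right hP hlogn)
  calc _ ≤ 4 * D * Real.sqrt n * Real.logb 2 (n : ℝ) / (n : ℝ) := by gcongr
    _ = 4 * D * Real.logb 2 (n : ℝ) / Real.sqrt n := by
      rw [div_eq_div_iff (by positivity) hs0.ne']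
      linear_combination (4 * D * Real.logb 2 (n : ℝ)) * hss
end

section
/- Let (tᵢ)_{i≥1} and (uᵢ)_{i≥1} be sequences of words over a finite alphabet Σ with uᵢ ≠ λ for all i ≥ 1. Then there exists a sequence of integers (Nᵢ)_{i≥1} such that for every sequence of integers (nᵢ)_{i≥1} with nᵢ ≥ Nᵢ for all i, the infinite sequence S = t₁u₁^{n₁} t₂u₂^{n₂} t₃u₃^{n₃} … satisfies R_LZ(S) = 0. -/
theorem LZcount_exists_phrases {A : Type*} [DecidableEq A] (x : List A) :
    ∀ dict cur : List _, ∃ (ps : List (List A)) (tail : List A), ps.Nodup ∧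
      (∀ p ∈ ps, p ∉ dict) ∧ cur ++ x = ps.flatten ++ tail ∧
      LZcount dict cur x ≤ ps.length + 1 := by
  induction x with
  | nil =>
    intro dict cur
    refine ⟨[], cur, by simp, by simp, by simp, ?_⟩
    rw [LZcount]
    split_ifs <;> simp
  | cons b rest ih =>
    intro dict cur
    rw [LZcount]
    split_ifs with h
    · obtain ⟨ps, tail, h1, h2, h3, h4⟩ := ih dict (cur ++ [b])
      exact ⟨ps, tail, h1, h2, by simpa using h3, h4⟩
    · obtain ⟨ps, tail, h1, h2, h3, h4⟩ := ih ((cur ++ [b]) :: dict) []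
      refine ⟨(cur ++ [b]) :: ps, tail, ?_, ?_, ?_, ?_⟩
      · exact List.nodup_cons.2 ⟨fun hm => h2 _ hm (by simp), h1⟩
      · intro p hp
        rcases List.mem_cons.1 hp with rfl | hp
        · exact h
        · exact fun hd => h2 p hp (List.mem_cons_of_mem _ hd)
      · simpa using h3
      · simpa using h4

theorem List.length_filter_le_length_mul_le_length_flatten {A : Type*} (s : ℕ)
    (ps : List (List A)) :
    (ps.filter (fun p => s ≤ p.length)).length * s ≤ ps.flatten.length := by
  induction ps with
  | nil => simp
  | cons p ps ih =>
    by_cases h : s ≤ p.length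
    · simp only [List.filter_cons, h, decide_true, if_true, List.length_cons, List.flatten_cons,
        List.length_append]
      linarith
    · simp only [List.filter_cons, h, decide_false, List.flatten_cons, List.length_append]
      exact ih.trans (Nat.le_add_left _ _)

/-- Phrases shorter than `s` are distinct factors of `x`, and there are at most `|x| / s`
others. -/
theorem LZP_mul_le {A : Type*} [DecidableEq A] (x : List A) (s : ℕ) (F : Finset (List A))
    (hF : ∀ w, w <:+: x → w.length < s → w ∈ F) :
    LZP x * s ≤ (F.card + 1) * s + x.length := by
  obtain ⟨ps, tail, h1, -, h3, h4⟩ := LZcount_exists_phrases x [] []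
  have hlong := List.length_filter_le_length_mul_le_length_flatten s ps
  have hlen : x.length = ps.flatten.length + tail.length := by
    rw [← List.length_append, ← h3, List.nil_append]
  have hshort : (ps.filter (fun p => !decide (s ≤ p.length))).length ≤ F.card := by
    rw [← List.toFinset_card_of_nodup (h1.filter _)]
    refine Finset.card_le_card fun w hw => ?_
    simp only [List.mem_toFinset, List.mem_filter, Bool.not_eq_true', decide_eq_false_iff_not,
      not_le] at hw
    refine hF w ?_ hw.2
    rw [List.nil_append] at h3
    rw [h3]
    exact (List.infix_of_mem_flatten hw.1).trans (List.prefix_append _ _).isInfix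
  have hsplit := List.length_eq_length_filter_add (l := ps) (fun p => decide (s ≤ p.length))
  have hP : LZP x ≤ ps.length + 1 := h4
  calc LZP x * s ≤ (ps.length + 1) * s := Nat.mul_le_mul_right s hP
    _ = (ps.filter (fun p => s ≤ p.length)).length * s +
        ((ps.filter (fun p => !decide (s ≤ p.length))).length + 1) * s := by
      rw [hsplit]; ring
    _ ≤ ps.flatten.length + (F.card + 1) * s := by gcongr
    _ ≤ _ := by omega

/-- The factor of length `l` of the sequence `S` starting at position `p`. -/
def seqFactor {A : Type*} (S : ℕ → A) (p l : ℕ) : List A :=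
  (List.range l).map fun k => S (p + k)

theorem eq_seqFactor_of_isInfix {A : Type*} (S : ℕ → A) (m : ℕ) (w : List A)
    (hw : w <:+: (List.range m).map S) :
    ∃ p, p + w.length ≤ m ∧ w = seqFactor S p w.length := by
  obtain ⟨a, b, h⟩ := hw
  have hl := congrArg List.length h
  simp only [List.length_append, List.length_map, List.length_range] at hl
  refine ⟨a.length, by omega, List.ext_getElem (by simp [seqFactor]) fun k hk _ => ?_⟩
  have h' : ((List.range m).map S)[a.length + k]? = some w[k] := by
    rw [← h]
    simp [List.getElem?_append, hk]
  rw [List.getElem?_eq_getElem (by simp; omega)] at h'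
  simp only [List.getElem_map, List.getElem_range, Option.some.injEq] at h'
  simp [seqFactor, h']

/-- Starting positions representing all factors of length less than `s` of a sequence which on
each interval `[a j, a (j + 1))` is `U j`-periodic after its first `T j` letters. -/
def factorReps (a T U : ℕ → ℕ) (s i : ℕ) : Finset ℕ :=
  (Finset.range (i + 1)).biUnion fun j =>
    Finset.Ico (a j) (a j + (T j + U j)) ∪ Finset.Ico (a (j + 1) + 1 - s) (a (j + 1))

theorem card_factorReps_le (a T U : ℕ → ℕ) (hU : ∀ j, 0 < U j) (s i : ℕ) (hs : 0 < s) :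
    (factorReps a T U s i).card ≤ (∑ j ∈ Finset.range (i + 1), (T j + U j)) * s := by
  rw [Finset.sum_mul]
  refine Finset.card_biUnion_le.trans (Finset.sum_le_sum fun j _ => ?_)
  refine (Finset.card_union_le _ _).trans ?_
  rw [Nat.card_Ico, Nat.card_Ico]
  obtain ⟨r, rfl⟩ : ∃ r, s = r + 1 := ⟨s - 1, by omega⟩
  have := hU j
  have : r ≤ (T j + U j) * r := Nat.le_mul_of_pos_left r (by omega)
  rw [mul_add]
  omega

theorem exists_mem_factorReps {A : Type*} (S : ℕ → A) (a T U : ℕ → ℕ) (h0 : a 0 = 0)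
    (hU : ∀ j, 0 < U j)
    (hper : ∀ j x y, a j + T j ≤ x → a j + T j ≤ y → x < a (j + 1) → y < a (j + 1) →
      x ≡ y [MOD U j] → S x = S y)
    (s i p l : ℕ) (hl : l < s) (hp : p < a (i + 1)) :
    ∃ q ∈ factorReps a T U s i, seqFactor S q l = seqFactor S p l := by
  obtain ⟨j, hj, hjp, hpj⟩ : ∃ j ≤ i, a j ≤ p ∧ p < a (j + 1) := by
    have hex : ∃ k, p < a (k + 1) := ⟨i, hp⟩
    classical
    refine ⟨Nat.find hex, Nat.find_min' hex hp, ?_, Nat.find_spec hex⟩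
    rcases hk : Nat.find hex with _ | k
    · omega
    · exact not_lt.1 (Nat.find_min hex (m := k) (by omega))
  have hmem : ∀ q, (a j ≤ q ∧ q < a j + (T j + U j)) ∨
      (a (j + 1) + 1 - s ≤ q ∧ q < a (j + 1)) → q ∈ factorReps a T U s i := by
    intro q hq
    simp only [factorReps, Finset.mem_biUnion, Finset.mem_range, Finset.mem_union, Finset.mem_Ico]
    exact ⟨j, by omega, hq⟩
  by_cases h1 : p < a j + (T j + U j)
  · exact ⟨p, hmem p (Or.inl ⟨hjp, h1⟩), rfl⟩
  by_cases h2 : a (j + 1) + 1 - s ≤ p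
  · exact ⟨p, hmem p (Or.inr ⟨h2, hpj⟩), rfl⟩
  have hlt := Nat.mod_lt (p - (a j + T j)) (hU j)
  have hle := Nat.mod_le (p - (a j + T j)) (U j)
  have hmod : a j + T j + (p - (a j + T j)) % U j ≡ p [MOD U j] := by
    have := (Nat.mod_modEq (p - (a j + T j)) (U j)).add_left (a j + T j)
    rwa [Nat.add_sub_cancel' (by omega)] at this
  refine ⟨a j + T j + (p - (a j + T j)) % U j, hmem _ (Or.inl (by omega)), ?_⟩
  refine List.map_congr_left fun k hk => ?_
  rw [List.mem_range] at hk
  exact hper j _ _ (by omega) (by omega) (by omega) (by omega) (hmod.add_right k)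

theorem LZP_mul_le_of_periodic_blocks {A : Type*} [DecidableEq A] (S : ℕ → A) (a T U : ℕ → ℕ)
    (h0 : a 0 = 0) (hU : ∀ j, 0 < U j)
    (hper : ∀ j x y, a j + T j ≤ x → a j + T j ≤ y → x < a (j + 1) → y < a (j + 1) →
      x ≡ y [MOD U j] → S x = S y)
    (s i m : ℕ) (hs : 0 < s) (hm0 : 0 < m) (hm : m ≤ a (i + 1)) :
    LZP ((List.range m).map S) * s ≤
      ((∑ j ∈ Finset.range (i + 1), (T j + U j)) * s ^ 2 + 1) * s + m := by
  let F : Finset (List A) := (factorReps a T U s i ×ˢ Finset.range s).image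
    fun z => seqFactor S z.1 z.2
  have hF : F.card ≤ (∑ j ∈ Finset.range (i + 1), (T j + U j)) * s ^ 2 := by
    refine Finset.card_image_le.trans ?_
    rw [Finset.card_product, Finset.card_range, pow_two, ← mul_assoc]
    exact Nat.mul_le_mul_right s (card_factorReps_le a T U hU s i hs)
  have key := LZP_mul_le ((List.range m).map S) s F ?_
  · rw [List.length_map, List.length_range] at key
    refine key.trans ?_
    gcongr
  · intro w hw hws
    obtain ⟨p, hp, hwp⟩ := eq_seqFactor_of_isInfix S m w hw
    have hrep : ∃ q ∈ factorReps a T U s i, seqFactor S q w.length = w := by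
      rcases Nat.eq_zero_or_pos w.length with hz | hpos
      · obtain ⟨q, hq, -⟩ := exists_mem_factorReps S a T U h0 hU hper s i 0 0 hs (by omega)
        refine ⟨q, hq, ?_⟩
        rw [List.length_eq_zero_iff.1 hz]
        rfl
      · obtain ⟨q, hq, h⟩ := exists_mem_factorReps S a T U h0 hU hper s i p w.length hws
          (by omega)
        exact ⟨q, hq, h.trans hwp.symm⟩
    obtain ⟨q, hq, h⟩ := hrep
    exact Finset.mem_image.2 ⟨(q, w.length),
      Finset.mem_product.2 ⟨hq, Finset.mem_range.2 hws⟩, h⟩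

theorem List.getElem?_flatten_replicate {A : Type*} (u : List A) (n k : ℕ)
    (hk : k < n * u.length) : (List.replicate n u).flatten[k]? = u[k % u.length]? := by
  induction n generalizing k with
  | zero => simp at hk
  | succ n ih =>
    rw [List.replicate_succ, List.flatten_cons, List.getElem?_append]
    split_ifs with h
    · rw [Nat.mod_eq_of_lt h]
    · rw [ih _ (by rw [add_mul] at hk; omega), ← Nat.mod_eq_sub_mod (by omega)]

theorem length_flatten_blocks {A : Type*} (t u : ℕ → List A) (n : ℕ → ℕ) (i : ℕ) :
    (((List.range i).map
      (fun j => t j ++ (List.replicate (n j) (u j)).flatten)).flatten).length =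
      ∑ j ∈ Finset.range i, ((t j).length + n j * (u j).length) := by
  induction i with
  | zero => simp
  | succ i ih =>
    rw [List.range_succ, List.map_append, List.flatten_append, List.length_append, ih,
      Finset.sum_range_succ]
    simp

theorem blocks_periodic {A : Type*} (t u : ℕ → List A) (n : ℕ → ℕ) (S : ℕ → A) (i : ℕ)
    (hS : (List.range (((List.range (i + 1)).map
              (fun j => t j ++ (List.replicate (n j) (u j)).flatten)).flatten.length)).map S =
            ((List.range (i + 1)).map
              (fun j => t j ++ (List.replicate (n j) (u j)).flatten)).flatten)
    (x y : ℕ)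
    (hx : ∑ j ∈ Finset.range i, ((t j).length + n j * (u j).length) + (t i).length ≤ x)
    (hy : ∑ j ∈ Finset.range i, ((t j).length + n j * (u j).length) + (t i).length ≤ y)
    (hx' : x < ∑ j ∈ Finset.range (i + 1), ((t j).length + n j * (u j).length))
    (hy' : y < ∑ j ∈ Finset.range (i + 1), ((t j).length + n j * (u j).length))
    (hxy : x ≡ y [MOD (u i).length]) : S x = S y := by
  set b := ∑ j ∈ Finset.range i, ((t j).length + n j * (u j).length) + (t i).length with hb
  have key : ∀ z, b ≤ z →
      z < ∑ j ∈ Finset.range (i + 1), ((t j).length + n j * (u j).length) →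
      some (S z) = (u i)[(z - b) % (u i).length]? := by
    intro z hz hz'
    have hlen := length_flatten_blocks t u n i
    have h : some (S z) = ((List.range (i + 1)).map
        (fun j => t j ++ (List.replicate (n j) (u j)).flatten)).flatten[z]? := by
      rw [← hS, length_flatten_blocks, List.getElem?_map, List.getElem?_range hz', Option.map_some]
    rw [Finset.sum_range_succ] at hz'
    rw [h, List.range_succ, List.map_append, List.flatten_append,
      List.getElem?_append_right (by omega), List.map_singleton, List.flatten_singleton,
      List.getElem?_append_right (by omega), List.getElem?_flatten_replicate _ _ _ (by omega),
      hlen, Nat.sub_sub]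
  have hmod : (x - b) % (u i).length = (y - b) % (u i).length := by
    have : (x - b) + b ≡ (y - b) + b [MOD (u i).length] := by
      rwa [Nat.sub_add_cancel hx, Nat.sub_add_cancel hy]
    exact Nat.ModEq.add_right_cancel' b this
  exact Option.some.inj (by rw [key x hx hx', key y hy hy', hmod])

theorem le_rpow_of_forall_mul_le (P C m : ℕ) (hC : 0 < C) (hCm : C ^ 6 ≤ m)
    (h : ∀ s, 0 < s → P * s ≤ (C * s ^ 2 + 1) * s + m) :
    (P : ℝ) ≤ 6 * (m : ℝ) ^ (5 / 6 : ℝ) := by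
  have hm1 : (1 : ℝ) ≤ m := by
    exact_mod_cast (Nat.one_le_pow 6 C hC).trans hCm
  have hm0 : (0 : ℝ) < m := by linarith
  set r : ℝ := (m : ℝ) ^ (1 / 6 : ℝ) with hr
  have hr1 : 1 ≤ r := Real.one_le_rpow hm1 (by norm_num)
  have hr6 : r ^ 6 = m := by
    rw [hr, ← Real.rpow_natCast, ← Real.rpow_mul hm0.le]; norm_num
  have hr5 : (m : ℝ) ^ (5 / 6 : ℝ) = r ^ 5 := by
    rw [hr, ← Real.rpow_natCast, ← Real.rpow_mul hm0.le]; norm_num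
  have hCr : (C : ℝ) ≤ r := by
    refine le_of_pow_le_pow_left₀ (n := 6) (by norm_num) (by linarith) ?_
    rw [hr6]; exact_mod_cast hCm
  have hs := h ⌈r ^ 2⌉₊ (Nat.ceil_pos.2 (by positivity))
  set s := ⌈r ^ 2⌉₊
  have hs1 : r ^ 2 ≤ s := Nat.le_ceil _
  have hs2 : (s : ℝ) ≤ 2 * r ^ 2 := by
    have := (Nat.ceil_lt_add_one (show 0 ≤ r ^ 2 by positivity)).le
    have : 1 ≤ r ^ 2 := one_le_pow₀ hr1
    linarith
  have hs' : (P : ℝ) * s ≤ (C * s ^ 2 + 1) * s + m := by exact_mod_cast hs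
  have hspos : (0 : ℝ) < s := by nlinarith
  have hms : (m : ℝ) ≤ r ^ 4 * s := by
    rw [← hr6]
    calc r ^ 6 = r ^ 4 * r ^ 2 := by ring
      _ ≤ _ := by gcongr
  have hP : (P : ℝ) ≤ C * s ^ 2 + 1 + r ^ 4 := by
    refine le_of_mul_le_mul_right (a := (s : ℝ)) ?_ hspos
    linarith
  have h4 : (C : ℝ) * s ^ 2 ≤ 4 * r ^ 5 := by
    calc (C : ℝ) * s ^ 2 ≤ r * (2 * r ^ 2) ^ 2 := by gcongr
      _ = 4 * r ^ 5 := by ring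
  have h5 : r ^ 4 ≤ r ^ 5 := pow_le_pow_right₀ hr1 (by norm_num)
  have h6 : 1 ≤ r ^ 5 := one_le_pow₀ hr1
  rw [hr5]
  linarith

theorem mul_logb_two_le (P m : ℕ) (hm : 0 < m) (h : (P : ℝ) ≤ 6 * (m : ℝ) ^ (5 / 6 : ℝ)) :
    (P : ℝ) * Real.logb 2 P ≤
      (10 * 6 ^ (11 / 10 : ℝ) / Real.log 2) * ((m : ℝ) * (m : ℝ) ^ (-(1 / 12) : ℝ)) := by
  have hm0 : (0 : ℝ) < m := by exact_mod_cast hm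
  have hlog2 : 0 < Real.log 2 := Real.log_pos (by norm_num)
  have h1 : Real.log P ≤ (P : ℝ) ^ (1 / 10 : ℝ) / (1 / 10) :=
    Real.log_le_rpow_div (Nat.cast_nonneg P) (by norm_num)
  have h2 : (P : ℝ) * (P : ℝ) ^ (1 / 10 : ℝ) = (P : ℝ) ^ (11 / 10 : ℝ) := by
    rw [← Real.rpow_one_add' (Nat.cast_nonneg P) (by norm_num)]; norm_num
  have h3 : (P : ℝ) ^ (11 / 10 : ℝ) ≤
      6 ^ (11 / 10 : ℝ) * ((m : ℝ) * (m : ℝ) ^ (-(1 / 12) : ℝ)) := by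
    calc (P : ℝ) ^ (11 / 10 : ℝ) ≤ (6 * (m : ℝ) ^ (5 / 6 : ℝ)) ^ (11 / 10 : ℝ) := by
          gcongr
      _ = _ := by
        rw [Real.mul_rpow (by norm_num) (by positivity), ← Real.rpow_mul hm0.le,
          ← Real.rpow_one_add' hm0.le (by norm_num)]
        norm_num
  calc (P : ℝ) * Real.logb 2 P = P * Real.log P / Real.log 2 := by
        rw [Real.logb]; ring
    _ ≤ P * ((P : ℝ) ^ (1 / 10 : ℝ) / (1 / 10)) / Real.log 2 := by gcongr
    _ = 10 * (P : ℝ) ^ (11 / 10 : ℝ) / Real.log 2 := by rw [← h2]; ring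
    _ ≤ 10 * (6 ^ (11 / 10 : ℝ) * ((m : ℝ) * (m : ℝ) ^ (-(1 / 12) : ℝ))) / Real.log 2 := by
        gcongr
    _ = _ := by ring

/-- Let `(tᵢ)` and `(uᵢ)` be sequences of words over a
finite alphabet `Σ` with `uᵢ ≠ λ` for all `i`.  Then there exists a sequence
of integers `(Nᵢ)` such that for every sequence of integers `(nᵢ)` with
`nᵢ ≥ Nᵢ` for all `i`, the infinite sequence
`S = t₀u₀^{n₀} t₁u₁^{n₁} t₂u₂^{n₂} …` satisfies `R_LZ(S) = 0`. -/
theorem lz_compresses_repetitive {A : Type} [Fintype A] [DecidableEq A]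
    (hA : 2 ≤ Fintype.card A) (t u : ℕ → List A) (hu : ∀ i, u i ≠ []) :
    ∃ N : ℕ → ℕ, ∀ n : ℕ → ℕ, (∀ i, N i ≤ n i) →
      ∀ S : ℕ → A,
        (∀ i : ℕ,
          (List.range (((List.range (i + 1)).map
              (fun j => t j ++ (List.replicate (n j) (u j)).flatten)).flatten.length)).map S =
            ((List.range (i + 1)).map
              (fun j => t j ++ (List.replicate (n j) (u j)).flatten)).flatten) →
        Filter.limsup
          (fun m : ℕ => LZlen ((List.range m).map S) /
            ((m : ℝ) * Real.logb 2 (Fintype.card A))) Filter.atTop = 0 := by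
  have hU : ∀ j, 0 < (u j).length := fun j => List.length_pos_iff.2 (hu j)
  let C : ℕ → ℕ := fun i => ∑ j ∈ Finset.range (i + 1), ((t j).length + (u j).length)
  have hC : ∀ i, 0 < C i := fun i =>
    Finset.sum_pos (fun j _ => Nat.add_pos_right _ (hU j)) (by simp)
  refine ⟨fun i => C (i + 1) ^ 6, fun n hn S hS => Filter.Tendsto.limsup_eq ?_⟩
  let a : ℕ → ℕ := fun i => ∑ j ∈ Finset.range i, ((t j).length + n j * (u j).length)
  have ha : ∀ i, a i + n i ≤ a (i + 1) := fun i => by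
    have : n i ≤ n i * (u i).length := Nat.le_mul_of_pos_right _ (hU i)
    simp only [a, Finset.sum_range_succ]
    omega
  have hmono : StrictMono a := strictMono_nat_of_lt_succ fun i => by
    have := (Nat.pow_pos (n := 6) (hC (i + 1))).trans_le (hn i)
    have := ha i
    omega
  have hP : ∀ m, a 1 < m → (LZP ((List.range m).map S) : ℝ) ≤ 6 * (m : ℝ) ^ (5 / 6 : ℝ) := by
    intro m hm
    have hex : ∃ k, m ≤ a (k + 1) := ⟨m, (Nat.le_succ m).trans (hmono.le_apply)⟩
    obtain ⟨i, hi, hi'⟩ : ∃ i, a (i + 1) < m ∧ m ≤ a (i + 2) := by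
      rcases hk : Nat.find hex with _ | k
      · have := Nat.find_spec hex
        rw [hk] at this
        exact absurd this hm.not_ge
      · refine ⟨k, not_le.1 (Nat.find_min hex (m := k) (by omega)), ?_⟩
        have := Nat.find_spec hex
        rwa [hk] at this
    refine le_rpow_of_forall_mul_le _ (C (i + 1)) m (hC _) ?_ fun s hs => ?_
    · have h1 := hn i
      have h2 := ha i
      simp only at h1
      omega
    · exact LZP_mul_le_of_periodic_blocks S a (fun j => (t j).length) (fun j => (u j).length)
        (by simp [a]) hU
        (fun j x y hx hy hx' hy' hxy => blocks_periodic t u n S j (hS j) x y hx hy hx' hy' hxy)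
        s (i + 1) m hs (by omega) hi'
  have hA1 : 1 ≤ Real.logb 2 (Fintype.card A) := by
    rw [Real.le_logb_iff_rpow_le (by norm_num) (by positivity)]
    simpa using (show (2 : ℝ) ≤ Fintype.card A by exact_mod_cast hA)
  have hlim : Filter.Tendsto
      (fun m : ℕ => (10 * 6 ^ (11 / 10 : ℝ) / Real.log 2) * (m : ℝ) ^ (-(1 / 12) : ℝ))
      Filter.atTop (nhds 0) := by
    simpa using ((tendsto_rpow_neg_atTop (show (0 : ℝ) < 1 / 12 by norm_num)).comp
      tendsto_natCast_atTop_atTop).const_mul (10 * 6 ^ (11 / 10 : ℝ) / Real.log 2)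
  have hnonneg : ∀ m, 0 ≤ LZlen ((List.range m).map S) := fun m => by
    have := Real.log_natCast_nonneg (LZP ((List.range m).map S))
    have : 0 < Real.log 2 := Real.log_pos (by norm_num)
    unfold LZlen Real.logb
    positivity
  refine squeeze_zero' (Filter.Eventually.of_forall fun m => ?_) ?_ hlim
  · exact div_nonneg (hnonneg m) (by positivity)
  · filter_upwards [Filter.eventually_gt_atTop (a 1)] with m hm
    have hm0 : (0 : ℝ) < m := by exact_mod_cast (Nat.zero_le _).trans_lt hm
    have hb := mul_logb_two_le _ m (by omega) (hP m hm)
    calc LZlen ((List.range m).map S) / ((m : ℝ) * Real.logb 2 (Fintype.card A))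
        ≤ LZlen ((List.range m).map S) / (m : ℝ) :=
          div_le_div_of_nonneg_left (hnonneg m) hm0 (le_mul_of_one_le_right hm0.le hA1)
      _ ≤ _ := by
        rw [div_le_iff₀ hm0]
        refine hb.trans (le_of_eq ?_)
        ring
end

section
/- Lempel-Ziv is not universal for pushdown compressors: for every m ∈ ℕ with m ≥ 1, there exists an infinite binary sequence S ∈ {0,1}^∞ such that ρ_LZ(S) > 1 − 1/m and R_PD(S) ≤ 1/2. -/
/-- `R_PD(S)`: the infimum, over all information-lossless pushdown
compressors `C` (without endmarker) over the binary alphabet, of the almost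
everywhere compression ratio `R_C(S) = limsup_n |C(S[0..n-1])|/n`. -/
noncomputable def RPD (S : ℕ → Bool) : ℝ :=
  sInf {r : ℝ | ∃ (Γ Q : Type) (_ : Fintype Γ) (_ : Fintype Q)
    (C : PDC Bool Γ Q), C.IL ∧
      r = Filter.limsup
        (fun n : ℕ => ((C.output ((List.range n).map S)).length : ℝ) / n)
        Filter.atTop}

open Polynomial in
theorem apply_mul_eq_zero_of_pow_lt_finrank {F E : Type*} [Field F] [Field E] [Algebra F E]
    [FiniteDimensional F E] (f : E →ₗ[F] F) (α δ : E)
    (h : ∀ y < Module.finrank F E, f (δ * α ^ y) = 0) (n : ℕ) : f (δ * α ^ n) = 0 := by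
  have hm : (minpoly F α).Monic := minpoly.monic (Algebra.IsIntegral.isIntegral α)
  have hα : α ^ n = aeval α ((X ^ n : F[X]) %ₘ minpoly F α) := by
    rw [modByMonic_eq_sub_mul_div]
    simp
  have hd : ((X ^ n : F[X]) %ₘ minpoly F α).natDegree < Module.finrank F E :=
    (natDegree_modByMonic_lt _ hm (minpoly.ne_one F α)).trans_le (minpoly.natDegree_le α)
  rw [hα, aeval_eq_sum_range' hd, Finset.mul_sum, map_sum]
  refine Finset.sum_eq_zero fun y hy => ?_
  rw [mul_smul_comm, map_smul, h y (Finset.mem_range.1 hy), smul_zero]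

/-- Linear feedback shift register sequences of maximal period: a binary sequence in which the
windows of length `K` at the first `2 ^ K - 1` positions are pairwise distinct. -/
theorem exists_windows_injective (K : ℕ) :
    ∃ w : ℕ → Bool, ∀ a b, a < 2 ^ K - 1 → b < 2 ^ K - 1 →
      (∀ y < K, w (a + y) = w (b + y)) → a = b := by
  rcases Nat.eq_zero_or_pos K with rfl | hK
  · exact ⟨fun _ => false, by simp⟩
  let E := GaloisField 2 K
  have : Fintype E := Fintype.ofFinite E
  obtain ⟨g, hg⟩ := IsCyclic.exists_generator (α := Eˣ)
  have hord : orderOf g = 2 ^ K - 1 := by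
    rw [orderOf_eq_card_of_forall_mem_zpowers hg, Nat.card_units,
      GaloisField.card 2 K hK.ne']
  obtain ⟨f, hf⟩ : ∃ f : E →ₗ[ZMod 2] ZMod 2, f 1 ≠ 0 := by
    by_contra! h
    exact one_ne_zero ((Module.forall_dual_apply_eq_zero_iff (ZMod 2) (1 : E)).1 h)
  refine ⟨fun n => decide (f ((g : E) ^ n) = 1), fun a b ha hb hab => ?_⟩
  have key : ∀ x y : ZMod 2, decide (x = 1) = decide (y = 1) → x = y := by decide
  have h0 : ∀ y < Module.finrank (ZMod 2) E, f (((g : E) ^ a - (g : E) ^ b) * (g : E) ^ y) = 0 := by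
    intro y hy
    rw [GaloisField.finrank 2 hK.ne'] at hy
    rw [sub_mul, map_sub, ← pow_add, ← pow_add, sub_eq_zero]
    exact key _ _ (hab y hy)
  have hpow : (g : E) ^ a = (g : E) ^ b := by
    by_contra hne
    have hδ : (g : E) ^ a - (g : E) ^ b ≠ 0 := sub_ne_zero.2 hne
    obtain ⟨n, hn⟩ := mem_powers_iff_mem_zpowers.2 (hg (Units.mk0 _ hδ)⁻¹)
    have hn' : (g : E) ^ n = ((g : E) ^ a - (g : E) ^ b)⁻¹ := by
      simpa using congrArg Units.val hn
    have h1 := apply_mul_eq_zero_of_pow_lt_finrank f _ _ h0 n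
    rw [hn', mul_inv_cancel₀ hδ] at h1
    exact hf h1
  have hpow' : g ^ a = g ^ b := Units.ext (by simpa using hpow)
  exact pow_injOn_Iio_orderOf (by simpa [hord] using ha) (by simpa [hord] using hb) hpow'

section LempelZiv

variable {A : Type*} [DecidableEq A]

theorem LZcount_parsing (x : List A) : ∀ (dict : List (List A)) (cur : List A),
    (∀ y ∈ dict, ∀ p, p ≠ [] → p <+: y → p ∈ dict) → (cur = [] ∨ cur ∈ dict) →
    ∃ (ys : List (List A)) (last : List A),
      (ys ++ if last = [] then [] else [last]).length = LZcount dict cur x ∧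
      ys.flatten ++ last = cur ++ x ∧ ys.Nodup ∧ [] ∉ ys ∧ (∀ y ∈ ys, y ∉ dict) ∧
      (last = [] ∨ last ∈ dict ∨ last ∈ ys) ∧
      ∀ y ∈ ys, ∀ p, p ≠ [] → p <+: y → p ∈ dict ∨ p ∈ ys := by
  induction x with
  | nil =>
    intro dict cur _ hc
    refine ⟨[], cur, ?_, ?_⟩
    · rw [LZcount]
      split_ifs <;> simp
    · simp only [List.flatten_nil, List.nil_append, List.append_nil, true_and]
      simp [hc]
  | cons b rest ih =>
    intro dict cur hd hc
    by_cases hm : cur ++ [b] ∈ dict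
    · obtain ⟨ys, last, h1, h2, h3⟩ := ih dict (cur ++ [b]) hd (Or.inr hm)
      refine ⟨ys, last, ?_, ?_, h3⟩
      · rw [h1, LZcount, if_pos hm]
      · simpa using h2
    · have hd' : ∀ y ∈ (cur ++ [b]) :: dict, ∀ p, p ≠ [] → p <+: y →
          p ∈ (cur ++ [b]) :: dict := by
        intro y hy p hp hpy
        rcases List.mem_cons.1 hy with rfl | hy
        · rcases List.prefix_concat_iff.1 (by simpa using hpy) with h | h
          · simp [h]
          · rcases hc with rfl | hc
            · exact absurd (List.prefix_nil.1 h) hp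
            · exact List.mem_cons_of_mem _ (hd _ hc _ hp h)
        · exact List.mem_cons_of_mem _ (hd _ hy _ hp hpy)
      obtain ⟨ys, last, h1, h2, h3, h4, h5, h6, h7⟩ := ih ((cur ++ [b]) :: dict) [] hd' (Or.inl rfl)
      refine ⟨(cur ++ [b]) :: ys, last, ?_, ?_, ?_, ?_, ?_, ?_, ?_⟩
      · rw [LZcount, if_neg hm, ← h1]
        simp
      · simpa using h2
      · refine List.nodup_cons.2 ⟨fun h => h5 _ h (by simp), h3⟩
      · simpa using h4
      · intro y hy
        rcases List.mem_cons.1 hy with rfl | hy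
        · exact hm
        · exact fun h => h5 y hy (List.mem_cons_of_mem _ h)
      · simp only [List.mem_cons] at h6 ⊢
        tauto
      · intro y hy p hp hpy
        rcases List.mem_cons.1 hy with rfl | hy
        · have := hd' _ (List.mem_cons_self) p hp hpy
          simp only [List.mem_cons] at this ⊢
          tauto
        · have := h7 y hy p hp hpy
          simp only [List.mem_cons] at this ⊢
          tauto

/-- The LZ78 parsing of `x`: a list of pairwise distinct nonempty phrases, closed under nonempty
prefixes, followed by a possibly empty last phrase which is a repetition. -/
theorem LZP_parsing (x : List A) : ∃ (ys : List (List A)) (last : List A),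
    (ys ++ if last = [] then [] else [last]).length = LZP x ∧
    ys.flatten ++ last = x ∧ ys.Nodup ∧ [] ∉ ys ∧ (last = [] ∨ last ∈ ys) ∧
    ∀ y ∈ ys, ∀ p, p ≠ [] → p <+: y → p ∈ ys := by
  obtain ⟨ys, last, h1, h2, h3, h4, -, h5, h6⟩ :=
    LZcount_parsing x [] [] (by simp) (Or.inl rfl)
  exact ⟨ys, last, h1, by simpa using h2, h3, h4, by simpa using h5, by simpa using h6⟩

theorem exists_phrases (x : List A) : ∃ zs : List (List A), zs.length = LZP x ∧ zs.flatten = x ∧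
    [] ∉ zs ∧ ∀ y ∈ zs, ∀ p, p ≠ [] → p <+: y → p ∈ zs := by
  obtain ⟨ys, last, h1, h2, -, h4, h5, h6⟩ := LZP_parsing x
  refine ⟨_, h1, ?_, ?_, ?_⟩
  · rw [← h2]
    split_ifs with h <;> simp [h]
  · split_ifs with h
    · simpa using h4
    · simp [h4, Ne.symm h]
  · split_ifs with h
    · simpa using h6
    · intro y hy p hp hpy
      have hy' : y ∈ ys := by
        rcases List.mem_append.1 hy with hy | hy
        · exact hy
        · obtain rfl := List.mem_singleton.1 hy
          exact h5.resolve_left h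
      exact List.mem_append_left _ (h6 y hy' p hp hpy)

/-- If, outside a set of at most `B` exceptional positions, every word of length `W` occurs at most
`G` times in the first `n` positions of `S`, then LZ78 splits the prefix of length `n` into many
phrases. -/
theorem le_LZP_mul_add (S : ℕ → A) (n W G : ℕ) (hW : 0 < W) (Bad : Finset ℕ)
    (hG : ∀ s₀, ((Finset.range n).filter fun s => s ∉ Bad ∧ ∀ z < W, S (s + z) = S (s₀ + z)).card
      ≤ G) :
    n ≤ LZP ((List.range n).map S) * (W + G) + Bad.card * (G + Bad.card) := by
  obtain ⟨zs, hlen, hflat, hne, hpre⟩ := exists_phrases ((List.range n).map S)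
  rw [← hlen]
  set P := zs.length with hP
  let st : Fin P → ℕ := fun q => (zs.take q).flatten.length
  have hstep : ∀ q (hq : q < P), (zs.take (q + 1)).flatten.length =
      (zs.take q).flatten.length + zs[q].length := by
    intro q hq
    rw [List.take_succ_eq_append_getElem hq]
    simp only [List.flatten_append, List.length_append]
    simp
  have hmono : ∀ a b, a ≤ b → (zs.take a).flatten.length ≤ (zs.take b).flatten.length := by
    intro a b hab
    exact ((List.take_prefix_take_left hab).flatten).length_le
  have hpos : ∀ q : Fin P, 0 < (zs[q]).length := by
    intro q
    rw [List.length_pos_iff]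
    intro h
    exact hne (h ▸ List.getElem_mem _)
  have hstlt : ∀ a b : Fin P, a < b → st a < st b := by
    intro a b hab
    have h1 := hmono (a + 1) b hab
    have h2 := hstep a a.2
    have h3 := hpos a
    simp only [Fin.getElem_fin] at h3
    show (zs.take a).flatten.length < (zs.take b).flatten.length
    omega
  have hstinj : Function.Injective st := StrictMono.injective fun a b => hstlt a b
  have htot : zs.flatten.length = n := by rw [hflat]; simp
  have hend : ∀ q : Fin P, st q + (zs[q]).length ≤ n := by
    intro q
    have h1 := hmono (q + 1) P q.2
    have h2 := hstep q q.2
    rw [List.take_of_length_le (Nat.le_refl _), htot] at h1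
    simp only [Fin.getElem_fin, st]
    omega
  have hwin : ∀ (q : Fin P) z (hz : z < (zs[q]).length), (zs[q])[z] = S (st q + z) := by
    intro q z hz
    have h1 : zs.flatten = (zs.take q).flatten ++ (zs[q] ++ (zs.drop (q + 1)).flatten) := by
      conv_lhs => rw [← List.take_append_drop q zs, List.drop_eq_getElem_cons q.2]
      rw [List.flatten_append, List.flatten_cons]
      rfl
    have h2 : zs.flatten[st q + z]? = some ((zs[q])[z]) := by
      rw [h1, List.getElem?_append_right (by simp [st])]
      simp only [st, Nat.add_sub_cancel_left]
      rw [List.getElem?_append_left hz, List.getElem?_eq_getElem hz]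
    rw [hflat, List.getElem?_map, List.getElem?_range (by have := hend q; omega)] at h2
    simpa using h2.symm
  let rel : Fin P → Fin P → Prop := fun q q' =>
    W ≤ (zs[q]).length ∧ W ≤ (zs[q']).length ∧ ∀ z < W, S (st q' + z) = S (st q + z)
  have hrels : ∀ q q', rel q q' → rel q' q := fun q q' h =>
    ⟨h.2.1, h.1, fun z hz => (h.2.2 z hz).symm⟩
  classical
  have hgood : ∀ q, (Finset.univ.filter fun q' => rel q q' ∧ st q' ∉ Bad).card ≤ G := by
    intro q
    refine le_trans ?_ (hG (st q))
    refine Finset.card_le_card_of_injOn st ?_ hstinj.injOn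
    intro q' hq'
    simp only [Finset.coe_filter, Finset.mem_univ, true_and, Set.mem_ofPred_eq,
      Finset.mem_range] at hq' ⊢
    have h1 := hend q'
    have h2 := hpos q'
    exact ⟨by omega, hq'.2, hq'.1.2.2⟩
  have hbad : (Finset.univ.filter fun q' => st q' ∈ Bad).card ≤ Bad.card :=
    Finset.card_le_card_of_injOn st (fun q' hq' => by simpa using hq') hstinj.injOn
  have hsplit : ∀ q, (Finset.univ.filter fun q' => rel q q').card ≤
      G + (Finset.univ.filter fun q' => rel q q' ∧ st q' ∈ Bad).card := by
    intro q
    have := Finset.card_filter_add_card_filter_not (s := Finset.univ.filter fun q' => rel q q')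
      (fun q' => st q' ∈ Bad)
    rw [Finset.filter_filter, Finset.filter_filter] at this
    have := hgood q
    omega
  have hclass : ∀ q, (Finset.univ.filter fun q' => rel q q').card ≤ G + Bad.card := by
    intro q
    refine (hsplit q).trans (Nat.add_le_add_left (le_trans (Finset.card_le_card ?_) hbad) _)
    intro q'
    simp +contextual
  have hl : ∀ q : Fin P, (zs[q]).length ≤ W + (Finset.univ.filter fun q' => rel q q').card := by
    intro q
    by_cases hq : W ≤ (zs[q]).length
    swap
    · omega
    have hex : ∀ t : ℕ, t ∈ Finset.Ico W (zs[q]).length →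
        ∃ q' : Fin P, zs[q'] = (zs[q]).take t := by
      intro t ht
      rw [Finset.mem_Ico] at ht
      have : (zs[q]).take t ∈ zs := by
        refine hpre _ (List.getElem_mem q.2) _ ?_ ⟨_, List.take_append_drop _ _⟩
        rw [← List.length_pos_iff]
        simp only [List.length_take]
        omega
      obtain ⟨k, hk, h⟩ := List.getElem_of_mem this
      exact ⟨⟨k, hk⟩, h⟩
    have : Nonempty (Fin P) := ⟨q⟩
    choose! c hc using hex
    have : (Finset.Ico W (zs[q]).length).card ≤ (Finset.univ.filter fun q' => rel q q').card := by
      refine Finset.card_le_card_of_injOn c ?_ ?_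
      · intro t ht
        have h1 := hc t ht
        rw [Finset.mem_coe, Finset.mem_Ico] at ht
        have h2 : (zs[c t]).length = t := by
          rw [h1, List.length_take]
          omega
        simp only [Finset.coe_filter, Finset.mem_univ, true_and, Set.mem_ofPred_eq]
        refine ⟨hq, by omega, fun z hz => ?_⟩
        rw [← hwin (c t) z (by omega), ← hwin q z (by omega)]
        simp only [h1, List.getElem_take]
      · intro t ht t' ht' h
        have h1 := hc t ht
        have h2 := hc t' ht'
        rw [Finset.mem_coe, Finset.mem_Ico] at ht ht'
        have h3 := congrArg List.length (h1.symm.trans (h ▸ h2))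
        simp only [List.length_take] at h3
        omega
    rw [Nat.card_Ico] at this
    omega
  have hsum : n = ∑ q : Fin P, (zs[q]).length := by
    refine htot.symm.trans ?_
    rw [List.length_flatten, ← List.sum_ofFn]
    congr 1
    refine List.ext_getElem (by simp [hP]) ?_
    intro i h1 h2
    simp
  have hdouble : ∑ q : Fin P, (Finset.univ.filter fun q' => rel q q' ∧ st q' ∈ Bad).card ≤
      Bad.card * (G + Bad.card) := by
    calc _ = ∑ q : Fin P, ((Finset.univ.filter fun q' => st q' ∈ Bad).filter
            fun q' => rel q q').card := by
          refine Finset.sum_congr rfl fun q _ => ?_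
          rw [Finset.filter_filter]
          simp only [and_comm]
      _ = ∑ q' ∈ Finset.univ.filter (fun q' => st q' ∈ Bad),
            (Finset.univ.filter fun q => rel q q').card := by
          simp only [Finset.card_filter]
          rw [Finset.sum_comm]
      _ ≤ ∑ q' ∈ Finset.univ.filter (fun q' => st q' ∈ Bad), (G + Bad.card) := by
          refine Finset.sum_le_sum fun q' _ => le_trans (Finset.card_le_card ?_) (hclass q')
          intro q hq
          simp only [Finset.mem_filter, Finset.mem_univ, true_and] at hq ⊢
          exact hrels _ _ hq
      _ ≤ _ := by
          rw [Finset.sum_const, smul_eq_mul]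
          exact Nat.mul_le_mul_right _ hbad
  calc n = ∑ q : Fin P, (zs[q]).length := hsum
    _ ≤ ∑ q : Fin P, ((W + G) + (Finset.univ.filter fun q' => rel q q' ∧ st q' ∈ Bad).card) :=
        Finset.sum_le_sum fun q _ => by
          have := hl q
          have := hsplit q
          omega
    _ ≤ _ := by
        rw [Finset.sum_add_distrib, Finset.sum_const, Finset.card_univ, Fintype.card_fin,
          smul_eq_mul]
        omega

end LempelZiv

/-- A set of nonempty binary words of total length `n` has `O(n / log n)` elements. -/
theorem card_mul_logb_le (ys : Finset (List Bool)) (h0 : [] ∉ ys) :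
    (ys.card : ℝ) * Real.logb 2 ys.card ≤ 2 * ∑ y ∈ ys, (y.length : ℝ) := by
  rcases ys.eq_empty_or_nonempty with rfl | hne
  · simp
  have hc : (0 : ℝ) < ys.card := by exact_mod_cast hne.card_pos
  have hkraft : ∑ y ∈ ys, (1 / 4 : ℝ) ^ y.length ≤ 1 := by
    set M := ys.sup List.length
    have hmaps : ∀ y ∈ ys, y.length ∈ Finset.Ico 1 (M + 1) := by
      intro y hy
      have h1 : y.length ≤ M := Finset.le_sup (f := List.length) hy
      have h2 : 0 < y.length := List.length_pos_iff.2 fun h => h0 (h ▸ hy)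
      rw [Finset.mem_Ico]
      omega
    rw [← Finset.sum_fiberwise_of_maps_to hmaps]
    have hfib : ∀ h ∈ Finset.Ico 1 (M + 1),
        ∑ y ∈ ys with y.length = h, (1 / 4 : ℝ) ^ y.length ≤ (1 / 2) ^ h := by
      intro h _
      have hcard : (ys.filter fun y => y.length = h).card ≤ 2 ^ h := by
        have : (ys.filter fun y => y.length = h).card ≤
            (Finset.univ : Finset (List.Vector Bool h)).card := by
          refine Finset.card_le_card_of_surjOn (fun v => v.1) ?_
          intro y hy
          simp only [Finset.coe_filter, Set.mem_ofPred_eq] at hy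
          exact ⟨⟨y, hy.2⟩, Finset.mem_coe.2 (Finset.mem_univ _), rfl⟩
        simpa [card_vector] using this
      calc ∑ y ∈ ys with y.length = h, (1 / 4 : ℝ) ^ y.length
          = ∑ y ∈ ys with y.length = h, (1 / 4 : ℝ) ^ h :=
            Finset.sum_congr rfl fun y hy => by rw [(Finset.mem_filter.1 hy).2]
        _ = (ys.filter fun y => y.length = h).card * (1 / 4 : ℝ) ^ h := by
            rw [Finset.sum_const, nsmul_eq_mul]
        _ ≤ (2 : ℝ) ^ h * (1 / 4 : ℝ) ^ h := by
            gcongr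
            exact_mod_cast hcard
        _ = (1 / 2) ^ h := by rw [← mul_pow]; norm_num
    refine (Finset.sum_le_sum hfib).trans ?_
    have hgeo : ∀ M : ℕ, ∑ h ∈ Finset.Ico 1 (M + 1), (1 / 2 : ℝ) ^ h = 1 - (1 / 2) ^ M := by
      intro M
      induction M with
      | zero => simp
      | succ M ih => rw [Finset.sum_Ico_succ_top (by omega), ih]; ring
    rw [hgeo]
    have : (0 : ℝ) ≤ (1 / 2) ^ M := by positivity
    linarith
  set T : ℝ := ∑ y ∈ ys, (y.length : ℝ)
  have hjensen : (ys.card : ℝ) * Real.exp (-(Real.log 4) * (T / ys.card)) ≤ 1 := by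
    have hj := convexOn_exp.map_sum_le (t := ys) (w := fun _ => (1 / (ys.card : ℝ)))
      (p := fun y => -(Real.log 4) * y.length) (fun _ _ => by positivity)
      (by rw [Finset.sum_const, nsmul_eq_mul]; field_simp) (fun _ _ => Set.mem_univ _)
    simp only [smul_eq_mul] at hj
    rw [← Finset.mul_sum, ← Finset.mul_sum, ← Finset.mul_sum] at hj
    have he : ∀ y ∈ ys, Real.exp (-(Real.log 4) * (y.length : ℝ)) = (1 / 4 : ℝ) ^ y.length := by
      intro y _
      rw [mul_comm, Real.exp_nat_mul, Real.exp_neg, Real.exp_log (by norm_num)]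
      norm_num
    rw [Finset.sum_congr rfl he] at hj
    calc (ys.card : ℝ) * Real.exp (-(Real.log 4) * (T / ys.card))
        = ys.card * Real.exp (1 / (ys.card : ℝ) * (-(Real.log 4) * T)) := by congr 2; ring
      _ ≤ ys.card * (1 / (ys.card : ℝ) * ∑ y ∈ ys, (1 / 4 : ℝ) ^ y.length) := by gcongr
      _ = ∑ y ∈ ys, (1 / 4 : ℝ) ^ y.length := by field_simp
      _ ≤ 1 := hkraft
  have hlog := Real.log_le_log (by positivity) hjensen
  rw [Real.log_one, Real.log_mul hc.ne' (Real.exp_ne_zero _), Real.log_exp] at hlog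
  have h4 : Real.log 4 = 2 * Real.log 2 := by
    rw [show (4 : ℝ) = 2 ^ 2 by norm_num, Real.log_pow]; norm_num
  have hl2 : 0 < Real.log 2 := Real.log_pos (by norm_num)
  rw [h4] at hlog
  rw [Real.logb]
  have : Real.log ys.card ≤ 2 * Real.log 2 * (T / ys.card) := by linarith
  calc (ys.card : ℝ) * (Real.log ys.card / Real.log 2)
      ≤ ys.card * (2 * Real.log 2 * (T / ys.card) / Real.log 2) := by gcongr
    _ = 2 * T := by field_simp

theorem LZlen_le (x : List Bool) : LZlen x ≤ 6 * x.length := by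
  obtain ⟨ys, last, h1, h2, h3, h4, h5, -⟩ := LZP_parsing x
  have hcard : ys.toFinset.card = ys.length := List.toFinset_card_of_nodup h3
  have hsum : ∑ y ∈ ys.toFinset, (y.length : ℝ) = ys.flatten.length := by
    rw [List.sum_toFinset _ h3, List.length_flatten]
    push_cast
    simp [Function.comp_def]
  have hmain := card_mul_logb_le ys.toFinset (by simpa using h4)
  rw [hcard, hsum] at hmain
  have hxl : (ys.flatten.length : ℝ) ≤ x.length := by
    rw [← h2]; simp
  rcases Nat.eq_zero_or_pos ys.length with h0 | hpos
  · obtain rfl := List.length_eq_zero_iff.1 h0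
    have : last = [] := by simpa using h5
    simp only [this, if_true, List.append_nil, List.length_nil] at h1
    simp [LZlen, ← h1]
  have hPle : LZP x ≤ ys.length + 1 := by
    rw [← h1]
    split_ifs <;> simp
  have hPpos : 0 < LZP x := by
    rw [← h1, List.length_append]; omega
  have hlenle : ys.length ≤ ys.flatten.length := by
    rw [List.length_flatten]
    have := List.card_nsmul_le_sum (ys.map List.length) 1 (by
      intro k hk
      obtain ⟨y, hy, rfl⟩ := List.mem_map.1 hk
      exact List.length_pos_iff.2 fun h => h4 (h ▸ hy))
    simpa using this
  set p : ℝ := (ys.length : ℝ)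
  have hp1 : (1 : ℝ) ≤ p := Nat.one_le_cast.2 hpos
  have hlenle' : p ≤ ys.flatten.length := Nat.cast_le.2 hlenle
  have hP2 : (LZP x : ℝ) ≤ 2 * p := by
    have : (LZP x : ℝ) ≤ (ys.length + 1 : ℕ) := Nat.cast_le.2 hPle
    push_cast at this
    linarith
  have hlog : Real.logb 2 (LZP x) ≤ 1 + Real.logb 2 p := by
    calc Real.logb 2 (LZP x) ≤ Real.logb 2 (2 * p) :=
          Real.logb_le_logb_of_le (by norm_num) (by exact_mod_cast hPpos) hP2
      _ = 1 + Real.logb 2 p := by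
          rw [Real.logb_mul (by norm_num) (by linarith)]; norm_num
  have hlp : 0 ≤ Real.logb 2 p := Real.logb_nonneg (by norm_num) hp1
  have hlP : 0 ≤ Real.logb 2 (LZP x) := Real.logb_nonneg (by norm_num) (Nat.one_le_cast.2 hPpos)
  calc LZlen x = LZP x * Real.logb 2 (LZP x) := rfl
    _ ≤ (2 * p) * (1 + Real.logb 2 p) := by gcongr
    _ = 2 * p + 2 * (p * Real.logb 2 p) := by ring
    _ ≤ 6 * x.length := by linarith

/-- The compressor which alternates between two modes.  In copying mode it outputs and pushes the
input, in units of `j + 1` symbols, until the last symbol of a unit is `true`.  It then pops the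
stack as long as the input agrees with it, acknowledging every `c` agreements by `false`; the first
disagreement is reported by `true ^ (i + 1) false`, where `i` is the number of agreements which have
not been acknowledged. -/
abbrev MirrorState (j c : ℕ) := Fin (j + 1) ⊕ Fin (c + 1)

namespace MirrorState

variable {j c : ℕ}

def copyNext (r : Fin (j + 1)) (b : Bool) : MirrorState j c :=
  if r.1 = j ∧ b = true then .inr 0 else .inl (r + 1)

/-- The successor state, the word replacing the top of the stack, and the output; the top of the
stack is `none` at the bottom of the stack. -/
def move : MirrorState j c → Bool → Option Bool → MirrorState j c × List Bool × List Bool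
  | .inl r, b, none => (copyNext r b, [b], [b])
  | .inl r, b, some z => (copyNext r b, [b, z], [b])
  | .inr _, b, none => (copyNext 0 b, [b], [false, b])
  | .inr i, b, some z =>
    if b = z then (.inr (i + 1), [], if i.1 = c then [false] else [])
    else (.inl 0, [z], List.replicate (i.1 + 1) true ++ [false])

/-- The configuration reached on a given input, and the output. -/
def run : MirrorState j c → List Bool → List Bool → (MirrorState j c × List Bool) × List Bool
  | q, l, [] => ((q, l), [])
  | q, l, b :: w =>
    let m := move q b l.head?
    let res := run m.1 (m.2.1 ++ l.tail) w
    (res.1, m.2.2 ++ res.2)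

theorem run_append (q : MirrorState j c) (l u v : List Bool) :
    run q l (u ++ v) = ((run (run q l u).1.1 (run q l u).1.2 v).1,
      (run q l u).2 ++ (run (run q l u).1.1 (run q l u).1.2 v).2) := by
  induction u generalizing q l with
  | nil => simp [run]
  | cons b u ih => simp [run, ih]

theorem run_inr_ne (w : List Bool) : ∀ (i : Fin (c + 1)) (l : List Bool) (k : ℕ) (o : List Bool),
    k ≤ i.1 + 1 → 1 ≤ k → (k = i.1 + 1 → ∃ z l' w', l = z :: l' ∧ w = z :: w') →
    (run (.inr i : MirrorState j c) l w).2 ≠ List.replicate k true ++ false :: o := by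
  induction w with
  | nil =>
    intro i l k o _ _ _
    simp [run]
  | cons b w ih =>
    intro i l k o hk hk1 hm
    obtain ⟨k, rfl⟩ := Nat.exists_eq_add_of_le' hk1
    cases l with
    | nil => simp [run, move, List.replicate_succ]
    | cons z l =>
      by_cases hbz : b = z
      · subst hbz
        by_cases hi : i.1 = c
        · simp [run, move, hi, List.replicate_succ]
        · have hi' : (i + 1).1 = i.1 + 1 := by
            rw [Fin.val_add_one_of_lt]
            exact Fin.lt_def.2 (by have := i.2; simp; omega)
          have := ih (i + 1) l (k + 1) o (by omega) (by omega) (by omega)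
          simpa [run, move, hi] using this
      · have hki : k < i.1 := by
          by_contra hcon
          obtain ⟨z', l', w', h1, h2⟩ := hm (by omega)
          simp_all
        intro h
        simp only [run, move, List.head?_cons, if_neg hbz] at h
        have h1 := congrArg (fun t => t[k + 1]?) h
        simp only [List.append_assoc] at h1
        rw [List.getElem?_append_left (by simp; omega),
          List.getElem?_append_right (by simp)] at h1
        simp [hki] at h1

theorem run_inr_eq_nil (w : List Bool) : ∀ (i : Fin (c + 1)) (l : List Bool),
    (run (.inr i : MirrorState j c) l w).2 = [] →
    ∃ i' : Fin (c + 1), (run (.inr i : MirrorState j c) l w).1.1 = .inr i' ∧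
      i'.1 = i.1 + w.length := by
  induction w with
  | nil =>
    intro i l _
    exact ⟨i, rfl, rfl⟩
  | cons b w ih =>
    intro i l h
    cases l with
    | nil => simp [run, move] at h
    | cons z l =>
      by_cases hbz : b = z
      · by_cases hi : i.1 = c
        · simp [run, move, hbz, hi] at h
        · have hi' : (i + 1).1 = i.1 + 1 := by
            rw [Fin.val_add_one_of_lt]
            exact Fin.lt_def.2 (by have := i.2; simp; omega)
          simp only [run, move, hbz, hi, List.head?_cons, if_true, if_false, List.nil_append,
            List.tail_cons] at h ⊢
          obtain ⟨i', h1, h2⟩ := ih (i + 1) l h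
          exact ⟨i', h1, by rw [h2, hi', List.length_cons]; omega⟩
      · simp [run, move, hbz] at h

theorem eq_nil_of_run (q : MirrorState j c) (l w : List Bool) (h : (run q l w).2 = [])
    (hq : (run q l w).1.1 = q) : w = [] := by
  cases q with
  | inl r =>
    cases w with
    | nil => rfl
    | cons b w => cases l <;> simp [run, move] at h
  | inr i =>
    obtain ⟨i', h1, h2⟩ := run_inr_eq_nil w i l h
    rw [h1] at hq
    obtain rfl := Sum.inr_injective hq
    exact List.length_eq_zero_iff.1 (by omega)

theorem run_injective (w : List Bool) : ∀ (w' : List Bool) (q : MirrorState j c) (l : List Bool),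
    (run q l w).2 = (run q l w').2 → (run q l w).1.1 = (run q l w').1.1 → w = w' := by
  induction w with
  | nil =>
    intro w' q l h1 h2
    exact (eq_nil_of_run q l w' h1.symm h2.symm).symm
  | cons b w ih =>
    intro w' q l h1 h2
    cases w' with
    | nil => exact eq_nil_of_run q l (b :: w) h1 h2
    | cons b' w' =>
      by_cases hb : b = b'
      · subst hb
        simp only [run, List.append_cancel_left_eq] at h1 h2
        rw [ih w' _ _ h1 h2]
      · exfalso
        cases q with
        | inl r => cases l <;> simp [run, move, hb] at h1
        | inr i =>
          cases l with
          | nil => simp [run, move, hb] at h1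
          | cons z l =>
            rcases (by cases b <;> cases b' <;> cases z <;> simp_all :
              (b = z ∧ b' ≠ z) ∨ (b' = z ∧ b ≠ z)) with ⟨rfl, hne⟩ | ⟨rfl, hne⟩
            · refine run_inr_ne (b :: w) i (b :: l) (i.1 + 1)
                (run (.inl 0 : MirrorState j c) (b :: l) w').2 le_rfl (by omega)
                (fun _ => ⟨b, l, w, rfl, rfl⟩) (h1.trans ?_)
              simp only [run, move, List.head?_cons, if_neg hne, List.append_assoc,
                List.singleton_append, List.tail_cons]
            · refine run_inr_ne (b' :: w') i (b' :: l) (i.1 + 1)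
                (run (.inl 0 : MirrorState j c) (b' :: l) w).2 le_rfl (by omega)
                (fun _ => ⟨b', l, w', rfl, rfl⟩) (h1.symm.trans ?_)
              simp only [run, move, List.head?_cons, if_neg hne, List.append_assoc,
                List.singleton_append, List.tail_cons]

theorem run_pop (l : List Bool) : ∀ (i : Fin (c + 1)) (rest : List Bool),
    ∃ i' : Fin (c + 1), (run (.inr i : MirrorState j c) (l ++ rest) l).1 = (.inr i', rest) ∧
      (c + 1) * (run (.inr i : MirrorState j c) (l ++ rest) l).2.length + i'.1 =
        i.1 + l.length := by
  induction l with
  | nil => intro i rest; exact ⟨i, by simp [run]⟩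
  | cons z l ih =>
    intro i rest
    obtain ⟨i', h1, h2⟩ := ih (i + 1) rest
    refine ⟨i', by simpa [run, move] using h1, ?_⟩
    by_cases hi : i.1 = c
    · have hi' : (i + 1).1 = 0 := by
        rw [show i = Fin.last c from Fin.ext hi]
        simp
      simp only [run, move, hi, List.cons_append, List.head?_cons, List.tail_cons, if_true,
        List.nil_append, List.length_cons, mul_add, mul_one]
      rw [hi'] at h2
      rw [mul_comm] at h2
      nlinarith
    · have hi' : (i + 1).1 = i.1 + 1 := by
        rw [Fin.val_add_one_of_lt]
        exact Fin.lt_def.2 (by have := i.2; simp; omega)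
      simp only [run, move, hi, List.cons_append, List.head?_cons, List.tail_cons, if_true, if_false,
        List.nil_append, List.length_cons]
      omega

/-- A word whose last symbol is the only `true` among the symbols at the ends of the units. -/
def IsBlock (j : ℕ) (H : ℕ) (f : ℕ → Bool) : Prop :=
  (j + 1) ∣ H ∧ 0 < H ∧ ∀ y < H, y % (j + 1) = j → (f y = true ↔ y + 1 = H)

theorem run_copy {H : ℕ} {f : ℕ → Bool} (hf : IsBlock j H f) (k : ℕ) (hk : k < H) (hk0 : 0 < k)
    (i : Fin (c + 1)) :
    run (.inr i : MirrorState j c) [] ((List.range k).map f) =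
      ((.inl (Fin.ofNat (j + 1) k), ((List.range k).map f).reverse),
        false :: (List.range k).map f) := by
  have hnext : ∀ k, k + 1 < H → copyNext (c := c) (Fin.ofNat (j + 1) k) (f k) =
      .inl (Fin.ofNat (j + 1) (k + 1)) := by
    intro k hk
    rw [copyNext, if_neg]
    · congr 1
      ext
      simp [Fin.val_add]
    · rintro ⟨h1, h2⟩
      have := (hf.2.2 k (by omega) (by simpa using h1)).1 h2
      omega
  induction k with
  | zero => omega
  | succ k ih =>
    rcases Nat.eq_zero_or_pos k with rfl | hk'
    · have := hnext 0 hk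
      rw [show (Fin.ofNat (j + 1) 0) = 0 from rfl] at this
      simp [run, move, this]
    · rw [List.range_succ, List.map_append, run_append, ih (by omega) hk']
      simp only [List.map_cons, List.map_nil, run, List.reverse_append]
      have hne : ((List.range k).map f).reverse ≠ [] := by simp; omega
      obtain ⟨z, l, hl⟩ := List.exists_cons_of_ne_nil hne
      rw [hl]
      simp only [move, List.head?_cons, hnext k hk]
      simp

theorem run_block {H : ℕ} {f : ℕ → Bool} (hj : 0 < j) (hf : IsBlock j H f) (i : Fin (c + 1)) :
    ∃ i' : Fin (c + 1),
      (run (.inr i : MirrorState j c) []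
        ((List.range H).map f ++ ((List.range H).map f).reverse)).1 = (.inr i', []) ∧
      ((run (.inr i : MirrorState j c) []
        ((List.range H).map f ++ ((List.range H).map f).reverse)).2.length : ℝ) ≤
        1 + H + H / (c + 1) := by
  obtain ⟨hdvd, hpos, hmark⟩ := hf
  have hle := Nat.le_of_dvd hpos hdvd
  obtain ⟨K, rfl⟩ : ∃ K, H = K + 1 := ⟨H - 1, by omega⟩
  have hmod : K % (j + 1) = j := by
    obtain ⟨a, ha⟩ := hdvd
    obtain ⟨a, rfl⟩ : ∃ a', a = a' + 1 := ⟨a - 1, by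
      rcases a with _ | a <;> simp_all⟩
    have : K = j + (j + 1) * a := by rw [mul_add] at ha; omega
    rw [this, Nat.add_mul_mod_self_left, Nat.mod_eq_of_lt (by omega)]
  have hfwd : run (.inr i : MirrorState j c) [] ((List.range (K + 1)).map f) =
      ((.inr 0, ((List.range (K + 1)).map f).reverse), false :: (List.range (K + 1)).map f) := by
    rw [List.range_succ, List.map_append, run_append,
      run_copy ⟨hdvd, hpos, hmark⟩ K (by omega) (by omega) i]
    have hne : ((List.range K).map f).reverse ≠ [] := by simp; omega
    obtain ⟨z, l, hl⟩ := List.exists_cons_of_ne_nil hne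
    have hfK : f K = true := (hmark K (by omega) hmod).2 rfl
    simp only [List.map_cons, List.map_nil, run, List.reverse_append, hl]
    simp [move, copyNext, hmod, hfK]
  obtain ⟨i', h1, h2⟩ := run_pop (j := j) ((List.range (K + 1)).map f).reverse (0 : Fin (c + 1)) []
  rw [List.append_nil] at h1 h2
  refine ⟨i', ?_, ?_⟩
  · rw [run_append, hfwd]
    exact h1
  · rw [run_append, hfwd]
    simp only [List.length_append, List.length_cons, List.length_map, List.length_range,
      List.length_reverse, Fin.val_zero, zero_add] at h2 ⊢
    set o := (run (.inr 0 : MirrorState j c) ((List.range (K + 1)).map f).reverse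
      ((List.range (K + 1)).map f).reverse).2.length
    have h3 : ((c + 1 : ℕ) : ℝ) * o ≤ (K + 1 : ℕ) := by
      exact_mod_cast (by omega : (c + 1) * o ≤ K + 1)
    have h4 : (o : ℝ) ≤ (K + 1 : ℕ) / (c + 1) := by
      rw [le_div_iff₀ (by positivity)]
      push_cast at h3 ⊢
      linarith
    push_cast at h4 ⊢
    linarith

end MirrorState

open MirrorState

/-- The pushdown transducer whose moves are given by `MirrorState.move`. -/
def mirrorPDT (j c : ℕ) : PDT Bool Bool (Option Bool) (MirrorState j c) where
  δ
    | _, none, _ => none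
    | q, some b, z => some ((move q b z).1, (move q b z).2.1.map some ++ if z = none then [none] else [])
  ν
    | _, none, _ => []
    | q, some b, z => (move q b z).2.2
  q₀ := .inr 0
  z₀ := none
  det _ _ := Or.inl rfl
  bottom := by
    rintro q (_ | b) p h
    · simp at h
    · simp only [Option.some.injEq, if_true] at h
      exact ⟨_, _, h.symm⟩

theorem mirrorPDT_computes (j c : ℕ) (w : List Bool) :
    (mirrorPDT j c).Computes w (run (.inr 0 : MirrorState j c) [] w).1.1
      (run (.inr 0 : MirrorState j c) [] w).2 := by
  have key : ∀ (w : List Bool) (q : MirrorState j c) (l o : List Bool),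
      Relation.ReflTransGen (PDT.Step (mirrorPDT j c)) (q, l.map some ++ [none], w, o)
        ((run q l w).1.1, (run q l w).1.2.map some ++ [none], [], o ++ (run q l w).2) := by
    intro w
    induction w with
    | nil => intro q l o; simpa [run] using Relation.ReflTransGen.refl
    | cons b w ih =>
      intro q l o
      refine Relation.ReflTransGen.head (b := ((move q b l.head?).1,
        ((move q b l.head?).2.1 ++ l.tail).map some ++ [none], w,
        o ++ (move q b l.head?).2.2)) ?_ ?_
      · cases l with
        | nil =>
          have := PDT.Step.read (M := mirrorPDT j c) (q := q) (z := none) (s := []) (b := b)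
            (inp := w) (out := o) rfl
          simpa [mirrorPDT] using this
        | cons z l =>
          have := PDT.Step.read (M := mirrorPDT j c) (q := q) (z := some z)
            (s := l.map some ++ [none]) (b := b) (inp := w) (out := o) rfl
          simpa [mirrorPDT] using this
      · simpa [run] using ih (move q b l.head?).1 ((move q b l.head?).2.1 ++ l.tail)
          (o ++ (move q b l.head?).2.2)
  exact ⟨_, key w (.inr 0) [] [], rfl, fun _ _ _ => rfl⟩

theorem PDT.Step.deterministic {In Out Γ Q : Type*} (M : PDT In Out Γ Q) {x y y' : PDT.ID In Out Γ Q}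
    (h : PDT.Step M x y) (h' : PDT.Step M x y') : y = y' := by
  cases h with
  | @lam q z s inp out q' v h =>
    cases h' with
    | lam h' => simp_all
    | read h' => rcases M.det q z with h0 | h0 <;> simp_all
  | @read q z s b inp out q' v h =>
    cases h' with
    | lam h' => rcases M.det q z with h0 | h0 <;> simp_all
    | read h' => simp_all

theorem PDT.Terminal.not_step_s16 {In Out Γ Q : Type*} (M : PDT In Out Γ Q) {x y : PDT.ID In Out Γ Q}
    (h : PDT.Terminal M x) : ¬ PDT.Step M x y := by
  intro h'
  cases h' with
  | lam h' => simp [PDT.Terminal, h'] at h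
  | read h' => simp [PDT.Terminal] at h

theorem PDT.Computes.unique {In Out Γ Q : Type*} {M : PDT In Out Γ Q} {w : List In} {q q' : Q}
    {o o' : List Out} (h : M.Computes w q o) (h' : M.Computes w q' o') : q = q' ∧ o = o' := by
  obtain ⟨s, h1, h2⟩ := h
  obtain ⟨s', h1', h2'⟩ := h'
  have key : ∀ {x y z : PDT.ID In Out Γ Q}, Relation.ReflTransGen (PDT.Step M) x y →
      PDT.Terminal M y → PDT.Terminal M z → Relation.ReflTransGen (PDT.Step M) x z → y = z := by
    intro x y z hxy hy hz
    induction hxy using Relation.ReflTransGen.head_induction_on with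
    | refl =>
      intro hyz
      rcases hyz.cases_head with h | ⟨a, ha, -⟩
      · exact h
      · exact absurd ha hy.not_step_s16
    | head hab _ ih =>
      intro haz
      rcases haz.cases_head with rfl | ⟨a, ha, haz⟩
      · exact absurd hab hz.not_step_s16
      · exact ih (PDT.Step.deterministic M hab ha ▸ haz)
  have := key h1 h2 h2' h1'
  simp_all

/-- The pushdown compressor of a sequence of palindromes. -/
def mirrorPDC (j c : ℕ) : PDC Bool (Option Bool) (MirrorState j c) where
  toPDT := mirrorPDT j c
  total w := ⟨_, _, mirrorPDT_computes j c w⟩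

theorem mirrorPDC_eq (j c : ℕ) (w : List Bool) :
    (mirrorPDC j c).finalState w = (run (.inr 0 : MirrorState j c) [] w).1.1 ∧
      (mirrorPDC j c).output w = (run (.inr 0 : MirrorState j c) [] w).2 :=
  PDT.Computes.unique ((mirrorPDC j c).total w).choose_spec.choose_spec
    (mirrorPDT_computes j c w)

theorem mirrorPDC_IL (j c : ℕ) : (mirrorPDC j c).IL := by
  intro w w' h
  simp only [Prod.mk.injEq, (mirrorPDC_eq j c _).1, (mirrorPDC_eq j c _).2] at h
  exact run_injective w w' _ _ h.1 h.2

/-- A binary sequence whose windows of length `K` at the first `2 ^ K - 1` positions are distinct. -/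
noncomputable def shiftRegister (K : ℕ) : ℕ → Bool := (exists_windows_injective K).choose

theorem shiftRegister_injective {K a b : ℕ} (ha : a < 2 ^ K - 1) (hb : b < 2 ^ K - 1)
    (h : ∀ y < K, shiftRegister K (a + y) = shiftRegister K (b + y)) : a = b :=
  (exists_windows_injective K).choose_spec a b ha hb h

namespace MirrorSeq

/-- The words of level `i` are made of windows of `unitsOf j i` units in a shift register. -/
def unitsOf (j i : ℕ) : ℕ := 3 * j * (i + 1) + 1

def level (j t : ℕ) : ℕ := Nat.log (2 ^ (j * j)) (t + 1)

def blockLen (j t : ℕ) : ℕ := (j + 1) * (t + 1) ^ 2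

/-- The `t`-th block: units of `j` symbols of a shift register, each of them followed by a mark
which tells whether the block is over. -/
noncomputable def block (j t y : ℕ) : Bool :=
  if y % (j + 1) = j then decide (y + 1 = blockLen j t)
  else shiftRegister (j * unitsOf j (level j t)) (j * ((t + 1) ^ 3 + y / (j + 1)) + y % (j + 1))

noncomputable def blockList (j t : ℕ) : List Bool := (List.range (blockLen j t)).map (block j t)

/-- The concatenation of the first `T` blocks, each of them followed by its mirror image. -/
noncomputable def word (j : ℕ) : ℕ → List Bool
  | 0 => []
  | T + 1 => word j T ++ (blockList j T ++ (blockList j T).reverse)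

/-- The infinite sequence of all the blocks, each of them followed by its mirror image. -/
noncomputable def seq (j n : ℕ) : Bool := (word j (n + 1)).getD n false

def start (j : ℕ) : ℕ → ℕ
  | 0 => 0
  | T + 1 => start j T + 2 * blockLen j T

theorem length_word (j T : ℕ) : (word j T).length = start j T := by
  induction T with
  | zero => rfl
  | succ T ih => simp [word, start, ih, blockList]; omega

theorem blockLen_pos (j t : ℕ) : 0 < blockLen j t := by
  unfold blockLen; positivity

theorem start_strictMono (j : ℕ) : StrictMono (start j) :=
  strictMono_nat_of_lt_succ fun T => by
    have := blockLen_pos j T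
    rw [start]; omega

theorem word_mono {j T T' : ℕ} (h : T ≤ T') : word j T <+: word j T' := by
  induction h with
  | refl => exact List.prefix_rfl
  | step _ ih => exact ih.trans (List.prefix_append _ _)

theorem getElem?_word {j T n : ℕ} (h : n < start j T) : (word j T)[n]? = some (seq j n) := by
  have hn : n < start j (n + 1) := (start_strictMono j).le_apply.trans_lt' (Nat.lt_succ_self n)
  have key : (word j T)[n]? = (word j (n + 1))[n]? := by
    rcases le_total T (n + 1) with h' | h'
    · obtain ⟨r, hr⟩ := word_mono (j := j) h'
      rw [← hr, List.getElem?_append_left (by rwa [length_word])]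
    · obtain ⟨r, hr⟩ := word_mono (j := j) h'
      rw [← hr, List.getElem?_append_left (by rwa [length_word])]
  rw [key, seq, List.getD_eq_getElem?_getD, List.getElem?_eq_getElem (by rwa [length_word])]
  simp

theorem map_seq_range {j T n : ℕ} (h : n ≤ start j T) :
    (List.range n).map (seq j) = (word j T).take n := by
  refine List.ext_getElem? fun i => ?_
  rw [List.getElem?_map, List.getElem?_take]
  split_ifs with hi
  · rw [getElem?_word (by omega), List.getElem?_range hi]
    rfl
  · rw [List.getElem?_eq_none (by simpa using hi)]
    rfl

theorem seq_start_add {j t y : ℕ} (hy : y < blockLen j t) : seq j (start j t + y) = block j t y := by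
  have h := getElem?_word (j := j) (T := t + 1) (n := start j t + y) (by rw [start]; omega)
  rw [word, List.getElem?_append_right (by simp [length_word]), length_word,
    Nat.add_sub_cancel_left, List.getElem?_append_left (by simpa [blockList] using hy), blockList,
    List.getElem?_map, List.getElem?_range hy] at h
  simpa using h.symm

theorem seq_start_add_blockLen_add {j t y : ℕ} (hy : y < blockLen j t) :
    seq j (start j t + blockLen j t + y) = block j t (blockLen j t - 1 - y) := by
  have h := getElem?_word (j := j) (T := t + 1) (n := start j t + blockLen j t + y)
    (by rw [start]; omega)
  rw [word, List.getElem?_append_right (by simp [length_word]; omega), length_word,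
    add_assoc, Nat.add_sub_cancel_left, List.getElem?_append_right (by simp [blockList])] at h
  simp only [blockList, List.length_map, List.length_range, Nat.add_sub_cancel_left] at h
  rw [List.getElem?_reverse (by simpa using hy), List.length_map, List.length_range,
    List.getElem?_map, List.getElem?_range (by omega)] at h
  simpa [add_assoc] using h.symm

theorem block_mul_add {j t u k : ℕ} (hj : 0 < j) :
    block j t ((j + 1) * (u + k / j) + k % j) =
      shiftRegister (j * unitsOf j (level j t)) (j * ((t + 1) ^ 3 + u) + k) := by
  have hk := Nat.mod_lt k hj
  have h1 : ((j + 1) * (u + k / j) + k % j) % (j + 1) = k % j := by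
    rw [Nat.mul_add_mod, Nat.mod_eq_of_lt (by omega)]
  have h2 : ((j + 1) * (u + k / j) + k % j) / (j + 1) = u + k / j := by
    have h3 : k % j / (j + 1) = 0 := Nat.div_eq_of_lt (by omega)
    rw [Nat.mul_add_div (by omega), h3, add_zero]
  rw [block, h1, h2, if_neg hk.ne]
  congr 1
  have := Nat.div_add_mod k j
  rw [← add_assoc, mul_add, add_assoc, this]

theorem offset_lt {j t u : ℕ} (hj : 0 < j) (hu : u < (t + 1) ^ 2) :
    j * ((t + 1) ^ 3 + u) < 2 ^ (j * unitsOf j (level j t)) - 1 := by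
  have h1 : t + 1 < (2 ^ (j * j)) ^ (level j t + 1) :=
    Nat.lt_pow_succ_log_self (Nat.one_lt_two_pow (by positivity)) _
  set M := (2 ^ (j * j)) ^ (level j t + 1) with hM
  have h2 : 2 ^ (j * unitsOf j (level j t)) = M ^ 3 * 2 ^ j := by
    rw [hM, unitsOf, ← pow_mul, ← pow_mul, ← pow_add]
    congr 1
    ring
  have h3 : (t + 2) ^ 3 ≤ M ^ 3 := Nat.pow_le_pow_left h1 3
  have h4 : j + 1 ≤ 2 ^ j := Nat.lt_two_pow_self
  have h5 : (t + 1) ^ 3 + u + 1 ≤ M ^ 3 := by nlinarith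
  have h6 : M ^ 3 * (j + 1) ≤ M ^ 3 * 2 ^ j := Nat.mul_le_mul_left _ h4
  have h7 : j * ((t + 1) ^ 3 + u + 1) ≤ j * M ^ 3 := Nat.mul_le_mul_left _ h5
  rw [h2]
  have h8 : 0 < M ^ 3 := by omega
  rw [mul_add] at h6
  rw [mul_add j _ 1] at h7
  have h9 := mul_comm j (M ^ 3)
  omega

theorem cube_add_injective {t t' u u' : ℕ} (hu : u < (t + 1) ^ 2) (hu' : u' < (t' + 1) ^ 2)
    (h : (t + 1) ^ 3 + u = (t' + 1) ^ 3 + u') : t = t' ∧ u = u' := by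
  have key : ∀ {t t' u u' : ℕ}, u < (t + 1) ^ 2 → t < t' → (t + 1) ^ 3 + u < (t' + 1) ^ 3 + u' := by
    intro t t' u u' hu ht
    have : (t + 2) ^ 3 ≤ (t' + 1) ^ 3 := Nat.pow_le_pow_left (by omega) 3
    nlinarith
  rcases lt_trichotomy t t' with ht | rfl | ht
  · exact absurd h (key hu ht).ne
  · exact ⟨rfl, by omega⟩
  · exact absurd h (key hu' ht).ne'

theorem block_window_injective {j t t' y y' W : ℕ} (hj : 0 < j) (hl : level j t = level j t')
    (hW : (unitsOf j (level j t) + 1) * (j + 1) ≤ W) (hy : y + W ≤ blockLen j t)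
    (hy' : y' + W ≤ blockLen j t') (hmod : y % (j + 1) = y' % (j + 1))
    (h : ∀ z < W, block j t (y + z) = block j t' (y' + z)) : t = t' ∧ y = y' := by
  obtain ⟨z₀, u, u', hz₀, hu, hu'⟩ : ∃ z₀ u u', z₀ ≤ j ∧ y + z₀ = (j + 1) * u ∧
      y' + z₀ = (j + 1) * u' := by
    have h1 := Nat.div_add_mod y (j + 1)
    have h2 := Nat.div_add_mod y' (j + 1)
    have h3 : y % (j + 1) < j + 1 := Nat.mod_lt _ (by omega)
    rcases Nat.eq_zero_or_pos (y % (j + 1)) with h0 | h0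
    · exact ⟨0, y / (j + 1), y' / (j + 1), by omega, by omega, by omega⟩
    · exact ⟨j + 1 - y % (j + 1), y / (j + 1) + 1, y' / (j + 1) + 1, by omega,
        by rw [mul_add]; omega, by rw [mul_add]; omega⟩
  set d := unitsOf j (level j t) with hd
  have hWj : j + 1 ≤ W := le_trans (Nat.le_mul_of_pos_left _ (by omega)) hW
  have hu1 : u < (t + 1) ^ 2 := by
    have : (j + 1) * u < (j + 1) * (t + 1) ^ 2 := by rw [← hu]; unfold blockLen at hy; omega
    exact lt_of_mul_lt_mul_left this (Nat.zero_le _)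
  have hu1' : u' < (t' + 1) ^ 2 := by
    have : (j + 1) * u' < (j + 1) * (t' + 1) ^ 2 := by rw [← hu']; unfold blockLen at hy'; omega
    exact lt_of_mul_lt_mul_left this (Nat.zero_le _)
  have hval : j * ((t + 1) ^ 3 + u) = j * ((t' + 1) ^ 3 + u') := by
    refine shiftRegister_injective (K := j * d) (offset_lt hj hu1) ?_ fun k hk => ?_
    · rw [hd, hl]
      exact offset_lt hj hu1'
    · have h1 : k / j < d := Nat.div_lt_of_lt_mul hk
      have h2 : (j + 1) * (k / j + 1) ≤ (j + 1) * d := Nat.mul_le_mul_left _ h1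
      have h3 := Nat.mod_lt k hj
      rw [mul_add] at h2
      rw [add_mul, mul_comm d] at hW
      have h4 := h (z₀ + (j + 1) * (k / j) + k % j) (by omega)
      rw [show y + (z₀ + (j + 1) * (k / j) + k % j) = (j + 1) * (u + k / j) + k % j by
          rw [mul_add, ← hu]; ring,
        show y' + (z₀ + (j + 1) * (k / j) + k % j) = (j + 1) * (u' + k / j) + k % j by
          rw [mul_add, ← hu']; ring, block_mul_add hj, block_mul_add hj, ← hl] at h4
      exact h4
  obtain ⟨rfl, rfl⟩ := cube_add_injective hu1 hu1' (Nat.eq_of_mul_eq_mul_left hj hval)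
  exact ⟨rfl, by omega⟩

theorem exists_start_le {j n : ℕ} : ∃ t, start j t ≤ n ∧ n < start j (t + 1) := by
  have h : ∃ t, n < start j (t + 1) :=
    ⟨n, (start_strictMono j).le_apply.trans_lt' (Nat.lt_succ_self n)⟩
  classical
  refine ⟨Nat.find h, ?_, Nat.find_spec h⟩
  rcases Nat.eq_zero_or_pos (Nat.find h) with h0 | h0
  · rw [h0]; exact Nat.zero_le _
  · have := Nat.find_min h (m := Nat.find h - 1) (by omega)
    rw [Nat.sub_add_cancel h0] at this
    omega

/-- The positions at which a window of length `W` may leave one of the first `T + 1` blocks or their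
mirror images. -/
def boundary (j T W : ℕ) : Finset ℕ :=
  (Finset.range (T + 1) ×ˢ Finset.range 2 ×ˢ Finset.range W).image fun p =>
    start j p.1 + p.2.1 * blockLen j p.1 + (blockLen j p.1 - 1 - p.2.2)

theorem card_boundary_le (j T W : ℕ) : (boundary j T W).card ≤ 2 * W * (T + 1) := by
  refine Finset.card_image_le.trans ?_
  simp only [Finset.card_product, Finset.card_range]
  exact (by ring : (T + 1) * (2 * W) = 2 * W * (T + 1)).le

theorem exists_of_notMem_boundary {j T W s : ℕ} (hs : s < start j (T + 1))
    (hb : s ∉ boundary j T W) : ∃ t h y, t ≤ T ∧ h < 2 ∧ y + W ≤ blockLen j t ∧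
      s = start j t + h * blockLen j t + y := by
  obtain ⟨t, h1, h2⟩ := exists_start_le (j := j) (n := s)
  have ht : t ≤ T := by
    have := (start_strictMono j).lt_iff_lt.1 (h1.trans_lt hs)
    omega
  rw [start] at h2
  obtain ⟨h, y, hh, hy, rfl⟩ : ∃ h y, h < 2 ∧ y < blockLen j t ∧
      s = start j t + h * blockLen j t + y := by
    by_cases hc : s < start j t + blockLen j t
    · exact ⟨0, s - start j t, by omega, by omega, by omega⟩
    · exact ⟨1, s - start j t - blockLen j t, by omega, by omega, by omega⟩
  refine ⟨t, h, y, ht, hh, ?_, rfl⟩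
  by_contra hyW
  refine hb (Finset.mem_image.2 ⟨(t, h, blockLen j t - 1 - y), ?_, ?_⟩)
  · simp only [Finset.mem_product, Finset.mem_range]
    omega
  · show start j t + h * blockLen j t + (blockLen j t - 1 - (blockLen j t - 1 - y)) = _
    omega

theorem level_mono (j : ℕ) {t T : ℕ} (h : t ≤ T) : level j t ≤ level j T :=
  Nat.log_mono_right (by omega)

/-- Inside the blocks and their mirror images, long words have few occurrences in `seq j`. -/
theorem card_occurrences_le {j T W n : ℕ} (hj : 0 < j)
    (hW : (unitsOf j (level j T) + 1) * (j + 1) ≤ W) (hn : n ≤ start j (T + 1)) (s₀ : ℕ) :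
    ((Finset.range n).filter fun s => s ∉ boundary j T W ∧
      ∀ z < W, seq j (s + z) = seq j (s₀ + z)).card ≤ (level j T + 1) * (2 * (j + 1)) := by
  have hex : ∀ s ∈ (Finset.range n).filter fun s => s ∉ boundary j T W ∧
      ∀ z < W, seq j (s + z) = seq j (s₀ + z), ∃ t h y, t ≤ T ∧ h < 2 ∧ y + W ≤ blockLen j t ∧
        s = start j t + h * blockLen j t + y := by
    intro s hs
    simp only [Finset.mem_filter, Finset.mem_range] at hs
    exact exists_of_notMem_boundary (by omega) hs.2.1
  choose! t h y ht hh hy hs using hex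
  have hWt : ∀ {t}, t ≤ T → (unitsOf j (level j t) + 1) * (j + 1) ≤ W := by
    intro t ht
    refine le_trans ?_ hW
    have := level_mono j ht
    unfold unitsOf
    gcongr
  let r : ℕ → ℕ := fun s => if h s = 0 then y s else blockLen j (t s) - W - y s
  have hcard : (Finset.range (level j T + 1) ×ˢ Finset.range 2 ×ˢ Finset.range (j + 1)).card =
      (level j T + 1) * (2 * (j + 1)) := by
    simp
  rw [← hcard]
  refine Finset.card_le_card_of_injOn (fun s => (level j (t s), h s, r s % (j + 1))) ?_ ?_
  · intro s hs'
    have h1 := level_mono j (ht s hs')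
    have h2 := hh s hs'
    have h3 : r s % (j + 1) < j + 1 := Nat.mod_lt _ (by omega)
    simp only [Finset.coe_product, Set.mem_prod, Finset.mem_coe, Finset.mem_range]
    omega
  · intro s hs' s' hs'' heq
    simp only [Prod.mk.injEq] at heq
    obtain ⟨hl, hheq, hr⟩ := heq
    have hwin : ∀ z < W, seq j (s + z) = seq j (s' + z) := by
      intro z hz
      have h1 := (Finset.mem_filter.1 hs').2.2 z hz
      have h2 := (Finset.mem_filter.1 hs'').2.2 z hz
      rw [h1, h2]
    have e := hs s hs'
    have e' := hs s' hs''
    have l := hy s hs'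
    have l' := hy s' hs''
    have hres : t s = t s' ∧ r s = r s' := by
      rcases Nat.lt_succ_iff.1 (hh s hs') |>.eq_or_lt with h1 | h1
      · have h1' := hheq.symm.trans h1
        simp only [r, h1, h1', one_ne_zero, if_false] at hr ⊢
        refine block_window_injective hj hl (hWt (ht s hs')) (by omega) (by omega) hr fun z hz => ?_
        have := hwin (W - 1 - z) (by omega)
        rw [h1, one_mul] at e
        rw [h1', one_mul] at e'
        rw [e, e', add_assoc (start j (t s) + _), add_assoc (start j (t s') + _),
          seq_start_add_blockLen_add (by omega), seq_start_add_blockLen_add (by omega)] at this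
        convert this using 2 <;> omega
      · have h1 : h s = 0 := by omega
        have h1' := hheq.symm.trans h1
        simp only [r, h1, h1', if_true] at hr ⊢
        refine block_window_injective hj hl (hWt (ht s hs')) l l' hr fun z hz => ?_
        have := hwin z hz
        rw [h1, zero_mul, add_zero] at e
        rw [h1', zero_mul, add_zero] at e'
        rwa [e, e', add_assoc, add_assoc, seq_start_add (by omega), seq_start_add (by omega)] at this
    have hyy : y s = y s' := by
      have h1 := hres.2
      simp only [r, hheq, hres.1] at h1
      rw [hres.1] at l
      split_ifs at h1 <;> omega
    rw [e, e', hres.1, hheq, hyy]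

theorem le_start (j T : ℕ) : 2 * (j + 1) * T ^ 3 ≤ 3 * start j T := by
  induction T with
  | zero => simp
  | succ T ih =>
    rw [start, blockLen]
    have : (j + 1) * (T + 1) ^ 3 ≤ (j + 1) * (T ^ 3 + 3 * (T + 1) ^ 2) :=
      Nat.mul_le_mul_left _ (by
        have : (T + 1) ^ 3 + (3 * T + 2) = T ^ 3 + 3 * (T + 1) ^ 2 := by ring
        omega)
    nlinarith

theorem isBlock_block (j t : ℕ) : MirrorState.IsBlock j (blockLen j t) (block j t) :=
  ⟨Dvd.intro _ rfl, blockLen_pos j t, fun y _ h => by simp [block, h]⟩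

theorem run_word {j c : ℕ} (hj : 0 < j) (T : ℕ) : ∃ i' : Fin (c + 1),
    (MirrorState.run (.inr 0 : MirrorState j c) [] (word j T)).1 = (.inr i', []) ∧
    ((MirrorState.run (.inr 0 : MirrorState j c) [] (word j T)).2.length : ℝ) ≤
      T + start j T / 2 * (1 + 1 / (c + 1)) := by
  induction T with
  | zero => exact ⟨0, rfl, by simp [word, MirrorState.run, start]⟩
  | succ T ih =>
    obtain ⟨i, h1, h2⟩ := ih
    obtain ⟨i', h3, h4⟩ := MirrorState.run_block hj (isBlock_block j T) i
    refine ⟨i', ?_, ?_⟩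
    · rw [word, MirrorState.run_append, h1]
      exact h3
    · rw [word, MirrorState.run_append, h1, List.length_append, start]
      rw [← blockList] at h4
      push_cast at h4 ⊢
      have : ((blockLen j T : ℝ)) / (c + 1) = blockLen j T * (1 / (c + 1)) := by ring
      linarith

theorem length_output_le {j c : ℕ} (hj : 0 < j) {T n : ℕ} (h1 : start j T ≤ n)
    (h2 : n ≤ start j (T + 1)) :
    (((mirrorPDC j c).output ((List.range n).map (seq j))).length : ℝ) ≤
      T + 1 + n / 2 * (1 + 1 / (c + 1)) + 2 * blockLen j T := by
  rw [(mirrorPDC_eq j c _).2, map_seq_range h2]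
  have hle : (MirrorState.run (.inr 0 : MirrorState j c) [] ((word j (T + 1)).take n)).2.length ≤
      (MirrorState.run (.inr 0 : MirrorState j c) [] (word j (T + 1))).2.length := by
    conv_rhs => rw [← List.take_append_drop n (word j (T + 1)), MirrorState.run_append]
    simp
  obtain ⟨i', -, h⟩ := run_word (c := c) hj (T + 1)
  have hle' := (Nat.cast_le (α := ℝ).2 hle).trans h
  rw [start] at hle'
  push_cast at hle'
  have h1' : (start j T : ℝ) ≤ n := Nat.cast_le.2 h1
  have hc : (1 : ℝ) / (c + 1) ≤ 1 := by
    rw [div_le_one (by positivity)]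
    have : (0 : ℝ) ≤ c := Nat.cast_nonneg c
    linarith
  have hB : (0 : ℝ) ≤ blockLen j T := Nat.cast_nonneg _
  have hx : (0 : ℝ) ≤ 1 / (c + 1) := by positivity
  nlinarith [mul_le_mul_of_nonneg_left hc hB, mul_le_mul_of_nonneg_right h1' hx]

/-- The number of phrases in the parsing of the prefixes of `seq j`. -/
theorem le_LZP_seq {j : ℕ} (hj : 0 < j) {T n : ℕ} (hn : n ≤ start j (T + 1)) :
    n ≤ LZP ((List.range n).map (seq j)) *
        ((j + 1) * ((3 * j + 2) * (level j T + 1) + 2)) +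
      8 * ((j + 1) * (3 * j * (level j T + 1) + 2) * (T + 1)) ^ 2 := by
  set W := (unitsOf j (level j T) + 1) * (j + 1) with hW
  set G := (level j T + 1) * (2 * (j + 1)) with hG
  set B := 2 * W * (T + 1) with hB
  have h1 := le_LZP_mul_add (seq j) n W G (by positivity) (boundary j T W)
    (card_occurrences_le hj le_rfl hn)
  have h2 := card_boundary_le j T W
  have hWe : W = (j + 1) * (3 * j * (level j T + 1) + 2) := by rw [hW, unitsOf]; ring
  have hWG : W + G = (j + 1) * ((3 * j + 2) * (level j T + 1) + 2) := by rw [hWe, hG]; ring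
  have hGB : G ≤ B := by
    rw [hG, hB, hWe]
    have : level j T + 1 ≤ 3 * j * (level j T + 1) + 2 := by nlinarith
    calc (level j T + 1) * (2 * (j + 1)) = 2 * ((j + 1) * (level j T + 1)) * 1 := by ring
      _ ≤ _ := by gcongr; omega
  rw [← hWG, ← hWe]
  have h3 : (boundary j T W).card * (G + (boundary j T W).card) ≤ B * (B + B) :=
    Nat.mul_le_mul h2 (Nat.add_le_add hGB h2)
  have h4 : B * (B + B) = 8 * (W * (T + 1)) ^ 2 := by rw [hB]; ring
  omega

open Filter Topology

theorem tendsto_of_start_le {j : ℕ} {τ : ℕ → ℕ} (h : ∀ n, n < start j (τ n + 1)) :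
    Tendsto τ atTop atTop := by
  refine tendsto_atTop.2 fun b => eventually_atTop.2 ⟨start j b, fun n hn => ?_⟩
  have := (start_strictMono j).lt_iff_lt.1 (hn.trans_lt (h n))
  omega

/-- The index of the block (or mirror image) which contains the position `n`. -/
noncomputable def index (j n : ℕ) : ℕ := (exists_start_le (j := j) (n := n)).choose

theorem start_index_le (j n : ℕ) : start j (index j n) ≤ n :=
  (exists_start_le (j := j) (n := n)).choose_spec.1

theorem lt_start_index (j n : ℕ) : n < start j (index j n + 1) :=
  (exists_start_le (j := j) (n := n)).choose_spec.2

theorem tendsto_index (j : ℕ) : Tendsto (index j) atTop atTop :=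
  tendsto_of_start_le (lt_start_index j)

theorem le_start_real (j T : ℕ) : 2 * (j + 1 : ℝ) * T ^ 3 ≤ 3 * start j T := by
  exact_mod_cast le_start j T

theorem limsup_output_le {j : ℕ} (hj : 0 < j) (c : ℕ) :
    limsup (fun n : ℕ => (((mirrorPDC j c).output ((List.range n).map (seq j))).length : ℝ) / n)
      atTop ≤ 1 / 2 + 1 / (c + 1) := by
  refine limsup_le_of_le (isCoboundedUnder_le_of_le atTop (x := 0) fun n => by positivity) ?_
  filter_upwards [(tendsto_index j).eventually_ge_atTop (36 * (c + 1))] with n hT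
  have h1 := start_index_le j n
  have h := length_output_le (c := c) hj h1 (lt_start_index j n).le
  set T := index j n
  have hs := le_start_real j T
  have h1' : (start j T : ℝ) ≤ n := Nat.cast_le.2 h1
  have hT' : 36 * ((c : ℝ) + 1) ≤ T := by exact_mod_cast hT
  have hc : (0 : ℝ) ≤ c := Nat.cast_nonneg c
  have hj' : (0 : ℝ) ≤ j := Nat.cast_nonneg j
  have hT1 : (1 : ℝ) ≤ T := by linarith
  have hB : (blockLen j T : ℝ) = (j + 1) * (T + 1) ^ 2 := by simp [blockLen]
  have hJT : (0 : ℝ) < (j + 1) * T ^ 2 := by positivity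
  have hn : (0 : ℝ) < n := by
    have : (0 : ℝ) < 2 * (j + 1) * T ^ 3 := by positivity
    linarith
  have h2 : (T : ℝ) + 1 + 2 * blockLen j T ≤ 12 * ((j + 1) * T ^ 2) := by
    have h3 : (T : ℝ) + 1 ≤ (j + 1) * (T + 1) ^ 2 := by nlinarith
    have h4 : ((T : ℝ) + 1) ^ 2 ≤ 4 * T ^ 2 := by nlinarith
    have h5 := mul_le_mul_of_nonneg_left h4 (by linarith : (0 : ℝ) ≤ j + 1)
    rw [hB]
    linarith
  have h3 : 12 * ((j + 1) * (T : ℝ) ^ 2) * (2 * (c + 1)) ≤ n := by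
    have := mul_le_mul_of_nonneg_left hT' hJT.le
    nlinarith
  have h4 : 12 * ((j + 1) * (T : ℝ) ^ 2) ≤ n / 2 * (1 / (c + 1)) := by
    rw [div_mul_div_comm, mul_one, le_div_iff₀ (by positivity)]
    exact h3
  rw [div_le_iff₀ hn]
  linarith

theorem RPD_seq_le {j : ℕ} (hj : 0 < j) : RPD (seq j) ≤ 1 / 2 := by
  refine le_of_forall_pos_le_add fun ε hε => ?_
  obtain ⟨c, hc⟩ := exists_nat_one_div_lt hε
  refine le_trans ?_ ((limsup_output_le hj c).trans (by linarith))
  refine csInf_le ⟨0, ?_⟩ ⟨_, _, inferInstance, inferInstance, mirrorPDC j c, mirrorPDC_IL j c, rfl⟩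
  rintro _ ⟨Γ, Q, _, _, C, -, rfl⟩
  rw [limsup_eq]
  refine Real.sInf_nonneg fun a ha => ?_
  obtain ⟨n, hn⟩ := ha.exists
  exact le_trans (by positivity) hn

/-- The average length of a phrase in the parsing of a prefix of `seq j` is about
`phraseLen j i` in the blocks of level `i`. -/
def phraseLen (j i : ℕ) : ℕ := (j + 1) * ((3 * j + 2) * (i + 1) + 2)

theorem le_LZlen_seq {j : ℕ} (hj : 0 < j) {T n : ℕ} (hT : 0 < T) (h1 : start j T ≤ n)
    (h2 : n ≤ start j (T + 1)) {δ : ℝ} (hδ₀ : 0 < δ) (hδ : δ ≤ 1 / 2)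
    (hW : 64 * (((j + 1) * (3 * j * (level j T + 1) + 2) : ℕ) : ℝ) ^ 2 ≤ δ * (T + 1)) :
    (1 - δ) * (3 * j ^ 2 * level j T - 4 - Real.logb 2 (phraseLen j (level j T))) /
      phraseLen j (level j T) * n ≤ LZlen ((List.range n).map (seq j)) := by
  have h3 := le_LZP_seq hj h2
  rw [← phraseLen] at h3
  rw [LZlen]
  have hTi : (2 ^ (j * j)) ^ level j T ≤ T + 1 := Nat.pow_log_le_self _ (by omega)
  have hs := le_start_real j T
  set P := LZP ((List.range n).map (seq j))
  set i := level j T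
  set W := (j + 1) * (3 * j * (i + 1) + 2)
  set V := phraseLen j i
  have h3' : (n : ℝ) ≤ P * V + 8 * (W * (T + 1)) ^ 2 := by exact_mod_cast h3
  have hV : (0 : ℝ) < V := by
    have : 0 < V := by simp only [V, phraseLen]; positivity
    exact_mod_cast this
  have hT1 : (1 : ℝ) ≤ T := by exact_mod_cast hT
  have hj1 : (1 : ℝ) ≤ j := by exact_mod_cast hj
  have h1' : (start j T : ℝ) ≤ n := Nat.cast_le.2 h1
  have hn : ((T : ℝ) + 1) ^ 3 ≤ 8 * n := by
    have h4 : ((T : ℝ) + 1) ^ 3 ≤ (2 * T) ^ 3 := by gcongr; linarith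
    have h5 : 2 * 2 * (T : ℝ) ^ 3 ≤ 2 * (j + 1) * T ^ 3 := by gcongr; linarith
    have h6 : (0 : ℝ) ≤ T ^ 3 := by positivity
    nlinarith
  have hn0 : (0 : ℝ) < n := by
    have : (0 : ℝ) < (T + 1) ^ 3 := by positivity
    linarith
  have h7 : 8 * ((W : ℝ) * (T + 1)) ^ 2 ≤ δ * n := by
    have h8 := mul_le_mul_of_nonneg_right hW (by positivity : (0 : ℝ) ≤ (T + 1) ^ 2)
    have h9 := mul_le_mul_of_nonneg_left hn hδ₀.le
    nlinarith
  have hP : (1 - δ) * n / V ≤ P := by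
    rw [div_le_iff₀ hV]
    linarith
  have hP0 : (0 : ℝ) < (1 - δ) * n / V := by
    have : 0 < 1 - δ := by linarith
    positivity
  have hP1 : (1 : ℝ) ≤ P := by
    have : (0 : ℝ) < P := hP0.trans_le hP
    exact_mod_cast this
  have hlog : 3 * (j : ℝ) ^ 2 * i - 4 - Real.logb 2 V ≤ Real.logb 2 P := by
    have h10 : (2 : ℝ) ^ (3 * j ^ 2 * i) / (2 ^ 4 * V) ≤ P := by
      refine le_trans ?_ hP
      rw [div_le_div_iff₀ (by positivity) hV]
      have h11 : (2 : ℝ) ^ (3 * j ^ 2 * i) ≤ (T + 1) ^ 3 := by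
        have : (((2 : ℝ) ^ (j * j)) ^ i) ≤ T + 1 := by exact_mod_cast hTi
        calc (2 : ℝ) ^ (3 * j ^ 2 * i) = ((2 ^ (j * j)) ^ i) ^ 3 := by
              rw [← pow_mul, ← pow_mul]; ring_nf
          _ ≤ _ := by gcongr
      have h12 : (2 : ℝ) ^ (3 * j ^ 2 * i) ≤ (1 - δ) * n * 2 ^ 4 := by nlinarith
      calc (2 : ℝ) ^ (3 * j ^ 2 * i) * V ≤ (1 - δ) * n * 2 ^ 4 * V := by gcongr
        _ = _ := by ring
    have h13 := Real.logb_le_logb_of_le one_lt_two (by positivity) h10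
    rw [Real.logb_div (by positivity) (by positivity), Real.logb_mul (by positivity) hV.ne',
      Real.logb_pow, Real.logb_pow, Real.logb_self_eq_one one_lt_two] at h13
    push_cast at h13
    linarith
  have hP2 : 0 ≤ Real.logb 2 (P : ℝ) := Real.logb_nonneg one_lt_two hP1
  calc (1 - δ) * (3 * j ^ 2 * i - 4 - Real.logb 2 V) / V * n
      = (1 - δ) * n / V * (3 * j ^ 2 * i - 4 - Real.logb 2 V) := by ring
    _ ≤ (1 - δ) * n / V * Real.logb 2 P := by gcongr
    _ ≤ P * Real.logb 2 P := by gcongr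

theorem tendsto_level {j : ℕ} (hj : 0 < j) : Tendsto (level j) atTop atTop := by
  refine tendsto_atTop.2 fun b => eventually_atTop.2 ⟨(2 ^ (j * j)) ^ b, fun t ht => ?_⟩
  exact Nat.le_log_of_pow_le (Nat.one_lt_two_pow (by positivity)) (by omega)

theorem tendsto_phraseLen (j : ℕ) :
    Tendsto (fun i => (phraseLen j i : ℝ)) atTop atTop := by
  refine tendsto_natCast_atTop_atTop.comp (tendsto_atTop_mono (fun i => ?_) tendsto_id)
  simp only [id, phraseLen]
  nlinarith [Nat.zero_le (j * i), Nat.zero_le (j * (3 * j + 2) * (i + 1))]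

theorem tendsto_ratio (j : ℕ) (δ : ℝ) :
    Tendsto (fun i : ℕ => (1 - δ) * (3 * j ^ 2 * i - 4 - Real.logb 2 (phraseLen j i)) /
      phraseLen j i) atTop (𝓝 ((1 - δ) * (3 * j ^ 2 / ((j + 1) * (3 * j + 2))))) := by
  have hV := tendsto_phraseLen j
  have h1 : Tendsto (fun i : ℕ => (1 : ℝ) / phraseLen j i) atTop (𝓝 0) :=
    hV.const_div_atTop 1
  have h2 : Tendsto (fun i : ℕ => Real.log (phraseLen j i) / phraseLen j i) atTop (𝓝 0) := by
    simpa [Function.comp_def] using Real.isLittleO_log_id_atTop.tendsto_div_nhds_zero.comp hV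
  set D : ℝ := (j + 1) * (3 * j + 2) with hD
  have hD0 : 0 < D := by positivity
  have hpos : ∀ i, (0 : ℝ) < phraseLen j i := by
    intro i
    have : 0 < phraseLen j i := by unfold phraseLen; positivity
    exact_mod_cast this
  have h3 : Tendsto (fun i : ℕ => (1 - δ) * (3 * j ^ 2 / D -
      (3 * j ^ 2 / D * (D + 2 * (j + 1)) + 4) * (1 / phraseLen j i) -
      (Real.log 2)⁻¹ * (Real.log (phraseLen j i) / phraseLen j i))) atTop
      (𝓝 ((1 - δ) * (3 * j ^ 2 / D - (3 * j ^ 2 / D * (D + 2 * (j + 1)) + 4) * 0 -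
        (Real.log 2)⁻¹ * 0))) :=
    ((tendsto_const_nhds.sub (h1.const_mul _)).sub (h2.const_mul _)).const_mul _
  simp only [mul_zero, sub_zero] at h3
  refine h3.congr fun i => ?_
  have hi : (i : ℝ) = (phraseLen j i - D - 2 * (j + 1)) / D := by
    rw [eq_div_iff hD0.ne', hD, phraseLen]
    push_cast
    ring
  have := hpos i
  rw [Real.logb, hi]
  field_simp
  ring

theorem eventually_sq_le (D : ℝ) {δ : ℝ} (hδ : 0 < δ) :
    ∀ᶠ i : ℕ in atTop, 64 * (D * (i + 1)) ^ 2 ≤ δ * 2 ^ i := by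
  have h1 := ((tendsto_pow_const_div_const_pow_of_one_lt 2 one_lt_two).comp
    (tendsto_add_atTop_nat 1)).const_mul (64 * D ^ 2 * 2)
  rw [mul_zero] at h1
  filter_upwards [h1.eventually_le_const hδ] with i hi
  simp only [Function.comp_apply] at hi
  rw [← mul_div_assoc, div_le_iff₀ (by positivity), pow_succ (2 : ℝ)] at hi
  push_cast at hi
  linarith

theorem lt_liminf_LZlen_seq {j : ℕ} (hj : 0 < j) {δ r : ℝ} (hδ₀ : 0 < δ) (hδ : δ ≤ 1 / 2)
    (hr : r < (1 - δ) * (3 * j ^ 2 / ((j + 1) * (3 * j + 2)))) :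
    r < liminf (fun n : ℕ => LZlen ((List.range n).map (seq j)) / n) atTop := by
  obtain ⟨r', hr', hr''⟩ := exists_between hr
  have hτ := tendsto_index j
  have hl := (tendsto_level hj).comp hτ
  refine hr'.trans_le (le_liminf_of_le ?_ ?_)
  · refine isCoboundedUnder_ge_of_le atTop (x := 6) fun n => ?_
    have := LZlen_le ((List.range n).map (seq j))
    refine div_le_of_le_mul₀ (Nat.cast_nonneg n) (by norm_num) ?_
    simpa using this
  · filter_upwards [hτ.eventually_gt_atTop 0,
      hl.eventually ((tendsto_ratio j δ).eventually_const_le hr''),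
      hl.eventually (eventually_sq_le ((j + 1) * (3 * j + 2)) hδ₀), eventually_gt_atTop 0]
      with n h1 h2 h3 h4
    simp only [Function.comp_apply] at h2 h3
    rw [le_div_iff₀ (by exact_mod_cast h4)]
    have h5 : (2 : ℝ) ^ level j (index j n) ≤ index j n + 1 := by
      have h6 : (2 ^ (j * j)) ^ level j (index j n) ≤ index j n + 1 :=
        Nat.pow_log_le_self _ (by omega)
      have h7 : 2 ^ level j (index j n) ≤ (2 ^ (j * j)) ^ level j (index j n) :=
        Nat.pow_le_pow_left (Nat.le_self_pow (by positivity) 2) _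
      exact_mod_cast h7.trans h6
    refine le_trans ?_ (le_LZlen_seq hj h1 (start_index_le j n) (lt_start_index j n).le hδ₀ hδ ?_)
    · gcongr
    · refine le_trans ?_ (h3.trans (mul_le_mul_of_nonneg_left h5 hδ₀.le))
      push_cast
      rw [mul_assoc ((j : ℝ) + 1)]
      gcongr
      nlinarith [(Nat.cast_nonneg (level j (index j n)) : (0 : ℝ) ≤ _)]

end MirrorSeq

/-- Lempel-Ziv is not universal for pushdown compressors:
for every `m ≥ 1` there exists an infinite binary sequence `S` such that
`ρ_LZ(S) > 1 - 1/m` and `R_PD(S) ≤ 1/2`. -/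
theorem lz_not_universal_for_pd (m : ℕ) (hm : 1 ≤ m) :
    ∃ S : ℕ → Bool,
      1 - 1 / (m : ℝ) <
        Filter.liminf (fun n : ℕ => LZlen ((List.range n).map S) / n)
          Filter.atTop ∧
      RPD S ≤ 1 / 2 := by
  have hm' : (1 : ℝ) ≤ m := by exact_mod_cast hm
  refine ⟨MirrorSeq.seq (2 * m), MirrorSeq.lt_liminf_LZlen_seq (δ := 1 / (12 * m)) (by omega)
    (by positivity) ?_ ?_, MirrorSeq.RPD_seq_le (by omega)⟩
  · gcongr
    linarith
  · push_cast
    rw [← sub_pos]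
    have : (1 - 1 / (12 * (m : ℝ))) * (3 * (2 * m) ^ 2 / ((2 * m + 1) * (3 * (2 * m) + 2))) -
        (1 - 1 / m) = (m ^ 2 + 8 * m + 2 : ℝ) / (m * ((2 * m + 1) * (6 * m + 2))) := by
      field_simp
      ring
    rw [this]
    positivity
end

section
/- For all integers k ≥ 1 and n ≥ 0, the number of binary strings of length n that do not contain 1^k (k consecutive ones) as a factor is at least 2^{(1−1/k)·n}. -/
/-- There are `2 ^ (n - n / k)` binary strings of length `n` in which every position
divisible by `k`, counted from the end, carries a zero. -/
theorem exists_finset_strings_zero_at_multiples (k n : ℕ) :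
    ∃ S : Finset (List Bool), S.card = 2 ^ (n - n / k) ∧
      ∀ x ∈ S, x.length = n ∧ ∀ t, true :: t <:+ x → ¬ k ∣ t.length + 1 := by
  induction n with
  | zero => exact ⟨{[]}, by simp, by simp⟩
  | succ n ih =>
    obtain ⟨S, hcard, hS⟩ := ih
    have hinj (b : Bool) : Function.Injective (List.cons b) := List.cons_injective
    have hle : n / k ≤ n := Nat.div_le_self n k
    by_cases hd : k ∣ n + 1
    · refine ⟨S.image (List.cons false), ?_, ?_⟩
      · rw [Finset.card_image_of_injective _ (hinj _), hcard, Nat.succ_div, if_pos hd]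
        congr 1
        omega
      · intro x hx
        obtain ⟨y, hy, rfl⟩ := Finset.mem_image.1 hx
        refine ⟨by simp [(hS y hy).1], fun t ht => ?_⟩
        rcases List.suffix_cons_iff.1 ht with h | h
        · simp at h
        · exact (hS y hy).2 t h
    · refine ⟨S.image (List.cons false) ∪ S.image (List.cons true), ?_, ?_⟩
      · rw [Finset.card_union_of_disjoint, Finset.card_image_of_injective _ (hinj _),
          Finset.card_image_of_injective _ (hinj _), hcard, Nat.succ_div, if_neg hd,
          show n + 1 - (n / k + 0) = n - n / k + 1 by omega, pow_succ, mul_two]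
        rw [Finset.disjoint_left]
        intro x hx hx'
        obtain ⟨y, -, rfl⟩ := Finset.mem_image.1 hx
        obtain ⟨z, -, h⟩ := Finset.mem_image.1 hx'
        simp at h
      · intro x hx
        obtain ⟨b, y, hy, rfl⟩ : ∃ b, ∃ y ∈ S, b :: y = x := by
          rcases Finset.mem_union.1 hx with h | h
          · exact ⟨false, Finset.mem_image.1 h⟩
          · exact ⟨true, Finset.mem_image.1 h⟩
        refine ⟨by simp [(hS y hy).1], fun t ht => ?_⟩
        rcases List.suffix_cons_iff.1 ht with h | h
        · obtain ⟨-, rfl⟩ := List.cons.inj h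
          rwa [(hS t hy).1]
        · exact (hS y hy).2 t h

/-- A string with zeros at all positions divisible by `k`, counted from the end, has no
block of `k` consecutive ones. -/
theorem not_replicate_infix_of_zero_at_multiples {k : ℕ} (hk : 1 ≤ k) {x : List Bool}
    (hx : ∀ t, true :: t <:+ x → ¬ k ∣ t.length + 1) : ¬ List.replicate k true <:+: x := by
  rintro ⟨s, t, rfl⟩
  have hlt : t.length % k < k := Nat.mod_lt _ hk
  obtain ⟨j, hj⟩ : ∃ j, j + t.length % k + 1 = k := ⟨k - 1 - t.length % k, by omega⟩
  refine hx (List.replicate j true ++ t) ?_ ?_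
  · refine ⟨s ++ List.replicate (t.length % k) true, ?_⟩
    rw [← List.cons_append, ← List.replicate_succ, ← List.append_assoc,
      List.append_assoc s, List.replicate_append_replicate,
      show t.length % k + (j + 1) = k by omega]
  · refine ⟨t.length / k + 1, ?_⟩
    have := Nat.div_add_mod t.length k
    rw [List.length_append, List.length_replicate, mul_add, mul_one]
    omega

/-- For all integers `k ≥ 1` and `n ≥ 0`, the number of
binary strings of length `n` that do not contain `1^k` (`k` consecutive
ones) as a factor is at least `2^{(1 - 1/k)·n}`. -/
theorem count_strings_avoiding_ones_block (k n : ℕ) (hk : 1 ≤ k) :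
    (2 : ℝ) ^ ((1 - 1 / (k : ℝ)) * (n : ℝ)) ≤
      (Set.ncard {x : List Bool | x.length = n ∧
        ¬ List.replicate k true <:+: x} : ℝ) := by
  obtain ⟨S, hcard, hS⟩ := exists_finset_strings_zero_at_multiples k n
  have hsub : (S : Set (List Bool)) ⊆ {x : List Bool | x.length = n ∧
      ¬ List.replicate k true <:+: x} := fun x hx =>
    ⟨(hS x hx).1, not_replicate_infix_of_zero_at_multiples hk (hS x hx).2⟩
  have hfin : {x : List Bool | x.length = n ∧ ¬ List.replicate k true <:+: x}.Finite :=
    (List.finite_length_eq Bool n).subset fun x hx => hx.1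
  have hle := Set.ncard_le_ncard hsub hfin
  rw [Set.ncard_coe_finset, hcard] at hle
  have hdiv : ((n / k : ℕ) : ℝ) ≤ (n : ℝ) / k := Nat.cast_div_le
  calc (2 : ℝ) ^ ((1 - 1 / (k : ℝ)) * (n : ℝ))
      ≤ (2 : ℝ) ^ ((n - n / k : ℕ) : ℝ) := by
        refine Real.rpow_le_rpow_of_exponent_le one_le_two ?_
        rw [Nat.cast_sub (Nat.div_le_self n k), sub_mul, one_mul, one_div_mul_eq_div]
        exact sub_le_sub_left hdiv _
    _ = ((2 ^ (n - n / k) : ℕ) : ℝ) := by rw [Real.rpow_natCast]; push_cast; rfl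
    _ ≤ _ := Nat.cast_le.2 hle
end
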